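/- arXiv:1004.5507 — 2 statements merged into one kernel-verified Lean document; each statement's English description precedes it below -/
import Mathlib

section
/- Sobolev–Poincaré inequality for Hajłasz–Sobolev functions: for s ∈ (0,1], p ∈ (0, n/s), and p* = np/(n−sp), there exists a constant C such that for all x ∈ ℝⁿ, r > 0, all u ∈ Ṁ^{s,p}(B(x,2r)) and all s-gradients g of u, inf_{c∈ℝ} ( ⨍_{B(x,r)} |u(y) − c|^{p*} dy )^{1/p*} ≤ C r^s ( ⨍_{B(x,2r)} g(y)^p dy )^{1/p}. -/
open MeasureTheory ENNReal

/-- `g` is an `s`-gradient of `u` on the set `B`. -/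
def IsHajlaszGradientOn {X : Type*} [MetricSpace X] [MeasurableSpace X]
    (μ : Measure X) (s : ℝ) (B : Set X) (u : X → ℝ) (g : X → ℝ≥0∞) : Prop :=
  Measurable g ∧
  ∃ E : Set X, μ E = 0 ∧ ∀ x ∈ B \ E, ∀ y ∈ B \ E,
    ENNReal.ofReal |u x - u y| ≤ ENNReal.ofReal (dist x y ^ s) * (g x + g y)

/-- Hajłasz's inequality between real numbers, at points where the gradient is bounded. -/
theorem abs_sub_le_of_gradient_le {X : Type*} [MetricSpace X] {s a b : ℝ} {u : X → ℝ}
    {g : X → ℝ≥0∞} {x y : X} (ha : 0 ≤ a) (hb : 0 ≤ b)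
    (h : ENNReal.ofReal |u x - u y| ≤ ENNReal.ofReal (dist x y ^ s) * (g x + g y))
    (hx : g x ≤ ENNReal.ofReal a) (hy : g y ≤ ENNReal.ofReal b) :
    |u x - u y| ≤ dist x y ^ s * (a + b) := by
  have hd : 0 ≤ dist x y ^ s := Real.rpow_nonneg dist_nonneg s
  rw [← ENNReal.ofReal_le_ofReal_iff (mul_nonneg hd (add_nonneg ha hb)),
    ENNReal.ofReal_mul hd, ENNReal.ofReal_add ha hb]
  exact h.trans (by gcongr)

/-- Chebyshev's inequality: a set of large measure contains a point, outside a given null set, where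
`g` is small. -/
theorem exists_mem_diff_le_of_lintegral_rpow_lt {X : Type*} [MeasurableSpace X] {μ : Measure X}
    {g : X → ℝ≥0∞} {B S E : Set X} {p T : ℝ} (hp : 0 < p) (hT : 0 < T) (hS : MeasurableSet S)
    (hSB : S ⊆ B) (hE : μ E = 0)
    (h : ∫⁻ y in B, g y ^ p ∂μ < ENNReal.ofReal (T ^ p) * μ S) :
    ∃ y ∈ S \ E, g y ≤ ENNReal.ofReal T := by
  by_contra! hcon
  refine absurd h (not_lt.2 ?_)
  calc ENNReal.ofReal (T ^ p) * μ S = ∫⁻ _ in S, ENNReal.ofReal (T ^ p) ∂μ := by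
        rw [setLIntegral_const]
    _ ≤ ∫⁻ y in S, g y ^ p ∂μ := by
        refine lintegral_mono_ae ?_
        have hE' : ∀ᵐ y ∂μ, y ∉ E := measure_eq_zero_iff_ae_notMem.1 hE
        filter_upwards [ae_restrict_mem hS, ae_restrict_of_ae hE'] with y hyS hyE
        rw [← ENNReal.ofReal_rpow_of_pos hT]
        exact ENNReal.rpow_le_rpow (hcon y ⟨hyS, hyE⟩).le hp.le
    _ ≤ ∫⁻ y in B, g y ^ p ∂μ := lintegral_mono_set hSB

/-- Chaining: if sublevel sets of the gradient are dense at geometrically decreasing scales, then the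
oscillation of `u` grows at most geometrically along the dyadic sublevel sets of the gradient. -/
theorem abs_sub_le_of_chain {X : Type*} [MetricSpace X] {u : X → ℝ} {g : X → ℝ≥0∞}
    {E : Set X} {x₀ y₀ : X} {r s q N : ℝ} (hr : 0 < r) (hs0 : 0 < s) (hs1 : s ≤ 1)
    (hq0 : 0 < q) (hq1 : q < 1) (hb : 1 < 2 * q ^ s) (hN : 0 < N)
    (hg : ∀ x ∈ Metric.ball x₀ (2 * r) \ E, ∀ y ∈ Metric.ball x₀ (2 * r) \ E,
      ENNReal.ofReal |u x - u y| ≤ ENNReal.ofReal (dist x y ^ s) * (g x + g y))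
    (hy₀ : y₀ ∈ Metric.ball x₀ (2 * r) \ E) (hgy₀ : g y₀ ≤ ENNReal.ofReal N)
    (hdense : ∀ (k : ℕ) (z : X), dist z x₀ < r * (1 + q ^ (k + 1)) →
      ∃ y ∈ Metric.ball z (r * (q ^ k - q ^ (k + 1))) \ E, g y ≤ ENNReal.ofReal (2 ^ k * N))
    (k : ℕ) (x : X) (hxE : x ∉ E) (hx : dist x x₀ < r * (1 + q ^ k))
    (hgx : g x ≤ ENNReal.ofReal (2 ^ k * N)) :
    |u x - u y₀| ≤ (8 + 4 / (2 * q ^ s - 1)) * (r ^ s * N) * (2 * q ^ s) ^ k := by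
  have hrs : 0 < r ^ s := Real.rpow_pos_of_pos hr s
  have hb' : 0 < 2 * q ^ s - 1 := by linarith
  have hball : ∀ (k : ℕ) (z : X), dist z x₀ < r * (1 + q ^ k) → z ∈ Metric.ball x₀ (2 * r) := by
    intro k z hz
    have : q ^ k ≤ 1 := pow_le_one₀ hq0.le hq1.le
    rw [Metric.mem_ball]
    nlinarith
  induction k generalizing x with
  | zero =>
    have hxB := hball 0 x hx
    have h := abs_sub_le_of_gradient_le (by positivity) hN.le (hg x ⟨hxB, hxE⟩ y₀ hy₀) hgx hgy₀
    have hd : dist x y₀ ≤ 4 * r := by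
      have := dist_triangle_right x y₀ x₀
      have h1 := Metric.mem_ball.1 hxB
      have h2 := Metric.mem_ball.1 hy₀.1
      linarith
    have hds : dist x y₀ ^ s ≤ 4 * r ^ s := by
      calc dist x y₀ ^ s ≤ (4 * r) ^ s := Real.rpow_le_rpow dist_nonneg hd hs0.le
        _ = 4 ^ s * r ^ s := Real.mul_rpow (by norm_num) hr.le
        _ ≤ 4 * r ^ s := by
          gcongr
          calc (4 : ℝ) ^ s ≤ 4 ^ (1 : ℝ) := Real.rpow_le_rpow_of_exponent_le (by norm_num) hs1
            _ = 4 := Real.rpow_one 4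
    calc |u x - u y₀| ≤ dist x y₀ ^ s * (2 ^ 0 * N + N) := h
      _ ≤ 4 * r ^ s * (2 ^ 0 * N + N) := by gcongr
      _ = 8 * (r ^ s * N) := by ring
      _ ≤ (8 + 4 / (2 * q ^ s - 1)) * (r ^ s * N) := by
        gcongr
        have : 0 < 4 / (2 * q ^ s - 1) := by positivity
        linarith
      _ = _ := by ring
  | succ k ih =>
    obtain ⟨y, ⟨hyb, hyE⟩, hgy⟩ := hdense k x hx
    rw [Metric.mem_ball] at hyb
    have hyx₀ : dist y x₀ < r * (1 + q ^ k) := by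
      have := dist_triangle y x x₀
      linarith
    have h := abs_sub_le_of_gradient_le (by positivity) (by positivity)
      (hg x ⟨hball _ x hx, hxE⟩ y ⟨hball _ y hyx₀, hyE⟩) hgx hgy
    have hds : dist x y ^ s ≤ r ^ s * (q ^ s) ^ k := by
      have hd : dist x y ≤ r * q ^ k := by
        rw [dist_comm]
        have : 0 < r * q ^ (k + 1) := by positivity
        linarith
      calc dist x y ^ s ≤ (r * q ^ k) ^ s := Real.rpow_le_rpow dist_nonneg hd hs0.le
        _ = r ^ s * (q ^ s) ^ k := by
          rw [Real.mul_rpow hr.le (by positivity), ← Real.rpow_natCast_mul hq0.le,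
            ← Real.rpow_mul_natCast hq0.le, mul_comm s]
    have hstep : |u x - u y| ≤ 4 * (r ^ s * N) * (2 * q ^ s) ^ k := by
      calc |u x - u y| ≤ dist x y ^ s * (2 ^ (k + 1) * N + 2 ^ k * N) := h
        _ ≤ r ^ s * (q ^ s) ^ k * (2 ^ (k + 1) * N + 2 ^ k * N) := by gcongr
        _ = 3 * (r ^ s * N) * (2 * q ^ s) ^ k := by rw [mul_pow]; ring
        _ ≤ _ := by gcongr; norm_num
    have hih := ih y hyE hyx₀ hgy
    calc |u x - u y₀| ≤ |u x - u y| + |u y - u y₀| := abs_sub_le _ _ _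
      _ ≤ 4 * (r ^ s * N) * (2 * q ^ s) ^ k
          + (8 + 4 / (2 * q ^ s - 1)) * (r ^ s * N) * (2 * q ^ s) ^ k := add_le_add hstep hih
      _ ≤ (8 + 4 / (2 * q ^ s - 1)) * (r ^ s * N) * (2 * q ^ s) ^ (k + 1) := by
        have hW : 0 ≤ (r ^ s * N) * (2 * q ^ s) ^ k := by positivity
        have h4 : 4 + (8 + 4 / (2 * q ^ s - 1)) ≤ (8 + 4 / (2 * q ^ s - 1)) * (2 * q ^ s) := by
          have : 4 / (2 * q ^ s - 1) * (2 * q ^ s - 1) = 4 := div_mul_cancel₀ _ hb'.ne'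
          nlinarith
        rw [pow_succ]
        nlinarith [mul_le_mul_of_nonneg_right h4 hW]

/-- Every value of the gradient lies in a dyadic layer; this turns geometric growth along the
dyadic levels into a power of the gradient. -/
theorem exists_dyadic_level {a : ℝ≥0∞} (ha : a ≠ ∞) {p A M : ℝ} (hp : 0 < p) (hA : 0 < A)
    (hM : 1 ≤ M) :
    ∃ k : ℕ, a ≤ ENNReal.ofReal (2 ^ k * (M * A)) ∧
      ENNReal.ofReal (((2 : ℝ) ^ p) ^ k) ≤
        1 + ENNReal.ofReal (2 ^ p / A ^ p) * a ^ p := by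
  classical
  lift a to NNReal using ha
  have hN : 0 < M * A := by positivity
  have hex : ∃ k : ℕ, (a : ℝ) ≤ 2 ^ k * (M * A) := by
    obtain ⟨k, hk⟩ := pow_unbounded_of_one_lt ((a : ℝ) / (M * A)) (one_lt_two)
    exact ⟨k, (div_le_iff₀ hN).1 hk.le⟩
  have hspec := Nat.find_spec hex
  refine ⟨Nat.find hex, ?_, ?_⟩
  · rw [← ENNReal.ofReal_coe_nnreal]
    exact ENNReal.ofReal_le_ofReal hspec
  · rcases hk : Nat.find hex with _ | k
    · simp
    · have hlt : 2 ^ k * (M * A) < (a : ℝ) := not_le.1 (Nat.find_min hex (by omega))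
      have hle : (2 : ℝ) ^ (k + 1) ≤ 2 / A * a := by
        rw [div_mul_eq_mul_div, le_div_iff₀ hA]
        have : (2 : ℝ) ^ k * A ≤ 2 ^ k * (M * A) := by
          gcongr
          nlinarith
        rw [pow_succ]
        linarith
      refine le_trans ?_ le_add_self
      rw [← ENNReal.ofReal_coe_nnreal, ENNReal.ofReal_rpow_of_nonneg a.coe_nonneg hp.le,
        ← ENNReal.ofReal_mul (by positivity)]
      refine ENNReal.ofReal_le_ofReal ?_
      calc ((2 : ℝ) ^ p) ^ (k + 1) = ((2 : ℝ) ^ (k + 1)) ^ p := by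
            rw [← Real.rpow_natCast_mul (by norm_num), ← Real.rpow_mul_natCast (by norm_num),
              mul_comm p]
        _ ≤ (2 / A * a) ^ p := Real.rpow_le_rpow (by positivity) hle hp.le
        _ = 2 ^ p / A ^ p * a ^ p := by
          rw [Real.mul_rpow (by positivity) a.coe_nonneg, Real.div_rpow (by norm_num) hA.le]

/-- The Sobolev–Poincaré inequality with any positive upper bound `A` for the normalized
`L^p`-norm of the gradient. -/
theorem exists_sobolev_poincare_const (n : ℕ) (hn : 0 < n) (s p : ℝ)
    (hs0 : 0 < s) (hs1 : s ≤ 1) (hp0 : 0 < p) (hp : s * p < n) :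
    ∃ C : ℝ, 0 < C ∧
      ∀ (x : EuclideanSpace ℝ (Fin n)) (r : ℝ) (u : EuclideanSpace ℝ (Fin n) → ℝ)
        (g : EuclideanSpace ℝ (Fin n) → ℝ≥0∞) (A : ℝ), 0 < r → 0 < A →
        IsHajlaszGradientOn volume s (Metric.ball x (2 * r)) u g →
        ∫⁻ y in Metric.ball x (2 * r), g y ^ p ≤
          ENNReal.ofReal (A ^ p) * volume (Metric.ball x (2 * r)) →
        ∃ c : ℝ, ((∫⁻ y in Metric.ball x r, ENNReal.ofReal |u y - c| ^ (n * p / (n - s * p))) /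
              volume (Metric.ball x r)) ^ ((n - s * p) / (n * p)) ≤
          ENNReal.ofReal (C * r ^ s * A) := by
  have hn' : (0 : ℝ) < n := by exact_mod_cast hn
  have hnsp : 0 < n - s * p := by linarith
  set P : ℝ := n * p / (n - s * p) with hP
  have hP0 : 0 < P := by positivity
  have hPinv : (n - s * p) / (n * p) = 1 / P := by rw [hP, one_div_div]
  rw [hPinv]
  set q : ℝ := 2 ^ (-(p / n)) with hq
  have hq0 : 0 < q := by positivity
  have hq1 : q < 1 := Real.rpow_lt_one_of_one_lt_of_neg (by norm_num)
    (neg_lt_zero.2 (by positivity))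
  have hqn : q ^ n = 2 ^ (-p) := by
    rw [hq, ← Real.rpow_mul_natCast (by norm_num)]
    congr 1
    field_simp
  have hbeq : 2 * q ^ s = 2 ^ (p / P) := by
    rw [hq, ← Real.rpow_mul (by norm_num), ← Real.rpow_one_add' (by norm_num)]
    · congr 1
      rw [hP]
      field_simp
      ring
    · have : 1 + -(p / n) * s = (n - s * p) / n := by field_simp; ring
      rw [this]
      positivity
  have hb : 1 < 2 * q ^ s := by
    rw [hbeq]
    exact Real.one_lt_rpow (by norm_num) (by positivity)
  have hbP : (2 * q ^ s) ^ P = 2 ^ p := by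
    rw [hbeq, ← Real.rpow_mul (by norm_num), div_mul_cancel₀ _ hP0.ne']
  have hq1' : 0 < 1 - q := by linarith
  set M : ℝ := (2 ^ (n + 1) / (1 - q) ^ n) ^ (1 / p) with hM
  have hMp : M ^ p = 2 ^ (n + 1) / (1 - q) ^ n := by
    rw [hM, one_div, Real.rpow_inv_rpow (by positivity) hp0.ne']
  have hM1 : 1 ≤ M := by
    refine Real.one_le_rpow ?_ (by positivity)
    rw [one_le_div (by positivity)]
    calc (1 - q) ^ n ≤ 1 := pow_le_one₀ hq1'.le (by linarith)
      _ ≤ 2 ^ (n + 1) := one_le_pow₀ (by norm_num)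
  have hM0 : 0 < M := by linarith
  set L : ℝ := (8 + 4 / (2 * q ^ s - 1)) * M with hL
  have hL0 : 0 < L := by
    have : 0 < 2 * q ^ s - 1 := by linarith
    positivity
  refine ⟨L * (1 + 2 ^ p * 2 ^ n) ^ (1 / P), by positivity, ?_⟩
  rintro x r u g A hr hA ⟨hgm, E, hE, hg⟩ hint
  have hN : 0 < M * A := by positivity
  set V : ℝ≥0∞ := volume (Metric.ball (0 : EuclideanSpace ℝ (Fin n)) 1) with hV
  have hV0 : V ≠ 0 := (Metric.measure_ball_pos volume _ one_pos).ne'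
  have hVt : V ≠ ∞ := measure_ball_lt_top.ne
  have hvol : ∀ (z : EuclideanSpace ℝ (Fin n)) (ρ : ℝ), 0 < ρ →
      volume (Metric.ball z ρ) = ENNReal.ofReal (ρ ^ n) * V := by
    intro z ρ hρ
    rw [Measure.addHaar_ball_of_pos volume z hρ, finrank_euclideanSpace_fin]
  have hdense : ∀ (k : ℕ) (z : EuclideanSpace ℝ (Fin n)), dist z x < r * (1 + q ^ (k + 1)) →
      ∃ y ∈ Metric.ball z (r * (q ^ k - q ^ (k + 1))) \ E,
        g y ≤ ENNReal.ofReal (2 ^ k * (M * A)) := by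
    intro k z hz
    have hδ : r * (q ^ k - q ^ (k + 1)) = r * (q ^ k * (1 - q)) := by ring
    have hqk : q ^ k ≤ 1 := pow_le_one₀ hq0.le hq1.le
    refine exists_mem_diff_le_of_lintegral_rpow_lt (B := Metric.ball x (2 * r)) hp0 (by positivity)
      measurableSet_ball (Metric.ball_subset_ball' ?_) hE (hint.trans_lt ?_)
    · nlinarith
    · rw [hδ, hvol _ _ (by positivity), hvol _ _ (by positivity), ← mul_assoc, ← mul_assoc,
        ENNReal.mul_lt_mul_iff_left hV0 hVt, ← ENNReal.ofReal_mul (by positivity),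
        ← ENNReal.ofReal_mul (by positivity)]
      refine (ENNReal.ofReal_lt_ofReal_iff (by positivity)).2 ?_
      have h1 : ((2 : ℝ) ^ k) ^ p * (q ^ k) ^ n = 1 := by
        rw [← pow_mul, mul_comm k n, pow_mul, hqn, ← Real.rpow_natCast_mul (by norm_num),
          ← Real.rpow_mul_natCast (by norm_num), ← Real.rpow_add (by norm_num)]
        ring_nf
        exact Real.rpow_zero 2
      calc A ^ p * (2 * r) ^ n = 2 ^ n * (A ^ p * r ^ n) := by rw [mul_pow]; ring
        _ < 2 ^ (n + 1) * (A ^ p * r ^ n) := by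
          gcongr
          · norm_num
          · omega
        _ = (((2 : ℝ) ^ k) ^ p * (q ^ k) ^ n) * (M ^ p * (1 - q) ^ n) * (A ^ p * r ^ n) := by
          rw [h1, hMp, div_mul_cancel₀ _ (by positivity), one_mul]
        _ = (2 ^ k * (M * A)) ^ p * (r * (q ^ k * (1 - q))) ^ n := by
          rw [Real.mul_rpow (by positivity) hN.le, Real.mul_rpow hM0.le hA.le, mul_pow, mul_pow]
          ring
  obtain ⟨y₀, ⟨hy₀b, hy₀E⟩, hgy₀⟩ := hdense 0 x (by rw [dist_self]; positivity)
  rw [pow_zero, one_mul] at hgy₀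
  have hy₀ : y₀ ∈ Metric.ball x (2 * r) \ E := by
    refine ⟨Metric.ball_subset_ball ?_ hy₀b, hy₀E⟩
    have : q ^ (0 + 1) > 0 := by positivity
    nlinarith
  have hfin : ∀ᵐ y ∂(volume.restrict (Metric.ball x (2 * r))), g y ^ p < ∞ := by
    refine ae_lt_top (hgm.pow_const p) (ne_top_of_le_ne_top ?_ hint)
    exact ENNReal.mul_ne_top ENNReal.ofReal_ne_top measure_ball_lt_top.ne
  have hsub : Metric.ball x r ⊆ Metric.ball x (2 * r) := Metric.ball_subset_ball (by linarith)
  have hpt : ∀ᵐ y ∂(volume.restrict (Metric.ball x r)), ENNReal.ofReal |u y - u y₀| ^ P ≤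
      ENNReal.ofReal ((L * (r ^ s * A)) ^ P) *
        (1 + ENNReal.ofReal (2 ^ p / A ^ p) * g y ^ p) := by
    have hE' : ∀ᵐ y ∂(volume : Measure (EuclideanSpace ℝ (Fin n))), y ∉ E :=
      measure_eq_zero_iff_ae_notMem.1 hE
    filter_upwards [ae_restrict_mem measurableSet_ball, ae_restrict_of_ae hE',
      ae_restrict_of_ae_restrict_of_subset hsub hfin] with y hyb hyE hyfin
    have hgy : g y ≠ ∞ := by
      intro h
      rw [h, ENNReal.top_rpow_of_pos hp0] at hyfin
      exact lt_irrefl _ hyfin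
    obtain ⟨k, hk1, hk2⟩ := exists_dyadic_level hgy hp0 hA hM1
    have hch := abs_sub_le_of_chain hr hs0 hs1 hq0 hq1 hb hN hg hy₀ hgy₀ hdense k y hyE
      (by
        have h1 := Metric.mem_ball.1 hyb
        have h2 : 0 < r * q ^ k := by positivity
        linarith) hk1
    have hch' : |u y - u y₀| ≤ L * (r ^ s * A) * (2 * q ^ s) ^ k := by
      refine hch.trans_eq ?_
      rw [hL]
      ring
    rw [ENNReal.ofReal_rpow_of_nonneg (abs_nonneg _) hP0.le]
    calc ENNReal.ofReal (|u y - u y₀| ^ P)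
        ≤ ENNReal.ofReal ((L * (r ^ s * A) * (2 * q ^ s) ^ k) ^ P) :=
          ENNReal.ofReal_le_ofReal (Real.rpow_le_rpow (abs_nonneg _) hch' hP0.le)
      _ = ENNReal.ofReal ((L * (r ^ s * A)) ^ P) * ENNReal.ofReal (((2 : ℝ) ^ p) ^ k) := by
          rw [Real.mul_rpow (by positivity) (by positivity), ENNReal.ofReal_mul (by positivity),
            ← hbP, ← Real.rpow_natCast_mul (by positivity), ← Real.rpow_mul_natCast (by positivity),
            mul_comm P]
      _ ≤ _ := by gcongr
  have hmain : ∫⁻ y in Metric.ball x r, ENNReal.ofReal |u y - u y₀| ^ P ≤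
      ENNReal.ofReal ((L * (r ^ s * A)) ^ P * (1 + 2 ^ p * 2 ^ n)) *
        volume (Metric.ball x r) := by
    calc ∫⁻ y in Metric.ball x r, ENNReal.ofReal |u y - u y₀| ^ P
        ≤ ∫⁻ y in Metric.ball x r, ENNReal.ofReal ((L * (r ^ s * A)) ^ P) *
            (1 + ENNReal.ofReal (2 ^ p / A ^ p) * g y ^ p) := lintegral_mono_ae hpt
      _ = ENNReal.ofReal ((L * (r ^ s * A)) ^ P) * (volume (Metric.ball x r) +
            ENNReal.ofReal (2 ^ p / A ^ p) * ∫⁻ y in Metric.ball x r, g y ^ p) := by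
          rw [lintegral_const_mul _ (by fun_prop), lintegral_add_left measurable_const,
            setLIntegral_one, lintegral_const_mul _ (by fun_prop)]
      _ ≤ ENNReal.ofReal ((L * (r ^ s * A)) ^ P) * (volume (Metric.ball x r) +
            ENNReal.ofReal (2 ^ p / A ^ p) *
              (ENNReal.ofReal (A ^ p) * volume (Metric.ball x (2 * r)))) := by
          gcongr
          exact (lintegral_mono_set hsub).trans hint
      _ = _ := by
          have h2 : ENNReal.ofReal (2 ^ p / A ^ p) * ENNReal.ofReal (A ^ p) =
              ENNReal.ofReal (2 ^ p) := by
            rw [← ENNReal.ofReal_mul (by positivity), div_mul_cancel₀ _ (by positivity)]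
          rw [hvol _ _ hr, hvol _ _ (by positivity), mul_pow, ← mul_assoc (ENNReal.ofReal _), h2,
            ENNReal.ofReal_mul (by positivity), ENNReal.ofReal_mul (by positivity),
            ENNReal.ofReal_add (by positivity) (by positivity),
            ENNReal.ofReal_mul (by positivity), ENNReal.ofReal_one]
          ring
  refine ⟨u y₀, ?_⟩
  calc _ ≤ ENNReal.ofReal ((L * (r ^ s * A)) ^ P * (1 + 2 ^ p * 2 ^ n)) ^ (1 / P) :=
        ENNReal.rpow_le_rpow (ENNReal.div_le_of_le_mul hmain) (by positivity)
    _ = _ := by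
      rw [ENNReal.ofReal_rpow_of_nonneg (by positivity) (by positivity),
        Real.mul_rpow (by positivity) (by positivity), one_div,
        Real.rpow_rpow_inv (by positivity) hP0.ne']
      congr 1
      ring

/-- Lemma 2.2: Sobolev–Poincaré inequality for Hajłasz–Sobolev functions on `ℝⁿ`:
for `s ∈ (0,1]`, `p ∈ (0,n/s)` and `p* = np/(n-sp)`,
`inf_c (⨍_{B(x,r)} |u-c|^{p*})^{1/p*} ≤ C r^s (⨍_{B(x,2r)} g^p)^{1/p}`. -/
theorem sobolev_poincare_hajlasz (n : ℕ) (hn : 0 < n) (s p : ℝ)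
    (hs0 : 0 < s) (hs1 : s ≤ 1) (hp0 : 0 < p) (hp : p < n / s) :
    ∃ C : ℝ, 0 < C ∧
      ∀ (x : EuclideanSpace ℝ (Fin n)) (r : ℝ) (u : EuclideanSpace ℝ (Fin n) → ℝ)
        (g : EuclideanSpace ℝ (Fin n) → ℝ≥0∞), 0 < r → Measurable u →
        IsHajlaszGradientOn volume s (Metric.ball x (2 * r)) u g →
        (⨅ c : ℝ, ((∫⁻ y in Metric.ball x r, ENNReal.ofReal |u y - c| ^ (n * p / (n - s * p))) /
              volume (Metric.ball x r)) ^ ((n - s * p) / (n * p))) ≤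
          ENNReal.ofReal (C * r ^ s) *
            ((∫⁻ y in Metric.ball x (2 * r), g y ^ p) /
              volume (Metric.ball x (2 * r))) ^ (1 / p) := by
  have hsp : s * p < n := by rwa [lt_div_iff₀ hs0, mul_comm] at hp
  obtain ⟨C, hC, h⟩ := exists_sobolev_poincare_const n hn s p hs0 hs1 hp0 hsp
  refine ⟨C, hC, fun x r u g hr _ hg ↦ ?_⟩
  have hCr : 0 < C * r ^ s := by positivity
  have hB0 : volume (Metric.ball x (2 * r)) ≠ 0 :=
    (Metric.measure_ball_pos volume x (by positivity)).ne'
  have hBt : volume (Metric.ball x (2 * r)) ≠ ∞ := measure_ball_lt_top.ne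
  rw [mul_comm (ENNReal.ofReal _), ← ENNReal.div_le_iff (by simpa using hCr) ENNReal.ofReal_ne_top]
  refine le_of_forall_gt_imp_ge_of_dense fun a ha ↦ ?_
  rcases eq_or_ne a ∞ with rfl | hat
  · exact le_top
  lift a to NNReal using hat
  have ha0 : 0 < (a : ℝ) := by
    have : (0 : ℝ≥0∞) < a := zero_le.trans_lt ha
    exact_mod_cast this
  rw [ENNReal.div_le_iff (by simpa using hCr) ENNReal.ofReal_ne_top, ← ENNReal.ofReal_coe_nnreal,
    mul_comm (ENNReal.ofReal _), ← ENNReal.ofReal_mul hCr.le]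
  obtain ⟨c, hc⟩ := h x r u g a hr ha0 hg (by
    rw [← ENNReal.div_le_iff hB0 hBt, ← ENNReal.ofReal_rpow_of_pos ha0,
      ENNReal.ofReal_coe_nnreal, ← ENNReal.rpow_inv_le_iff hp0, ← one_div]
    exact ha.le)
  exact (iInf_le _ c).trans hc
end

section
/- Quasisymmetric invariance with matching conformal exponents: let X be Ahlfors n₁-regular, Y Ahlfors n₂-regular, f : X → Y an η-quasisymmetric homeomorphism, and s₁ ∈ (0,n₁), s₂ ∈ (0,n₂) with n₁/s₁ = n₂/s₂. Then composition with f induces an equivalence between the Hajłasz–Triebel–Lizorkin spaces Ṁ^{s₁}_{n₁/s₁, n₁/s₁}(X) and Ṁ^{s₂}_{n₂/s₂, n₂/s₂}(Y): every u in the latter has a representative ũ with ũ∘f in the former and ‖ũ∘f‖ ≲ ‖u‖, and symmetrically for f⁻¹. -/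
open MeasureTheory ENNReal

/-- `g` is a fractional `s`-Hajłasz gradient of `u` (Definition 1.1), `𝔻^s(u)`. -/
def IsFracHajlaszGradient {X : Type*} [MetricSpace X] [MeasurableSpace X]
    (μ : Measure X) (s : ℝ) (u : X → ℝ) (g : ℤ → X → ℝ≥0∞) : Prop :=
  (∀ k, Measurable (g k)) ∧
  ∃ E : Set X, μ E = 0 ∧ ∀ (k : ℤ), ∀ x ∉ E, ∀ y ∉ E,
    (2 : ℝ) ^ (-k - 1) ≤ dist x y → dist x y < (2 : ℝ) ^ (-k) →
    ENNReal.ofReal |u x - u y| ≤ ENNReal.ofReal (dist x y ^ s) * (g k x + g k y)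

/-- The Hajłasz–Triebel–Lizorkin norm `‖u‖_{Ṁ^s_{p,p}(X)}`. -/
noncomputable def hajlaszTLNorm {X : Type*} [MetricSpace X] [MeasurableSpace X]
    (μ : Measure X) (s p : ℝ) (u : X → ℝ) : ℝ≥0∞ :=
  ⨅ g ∈ {g : ℤ → X → ℝ≥0∞ | IsFracHajlaszGradient μ s u g},
    (∫⁻ x, ∑' k : ℤ, g k x ^ p ∂μ) ^ (1 / p)

/-- `f` is `η`-quasisymmetric, where `η` is an increasing homeomorphism of `[0,∞)`. -/
structure IsQuasisymmetric {X Y : Type*} [MetricSpace X] [MetricSpace Y]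
    (f : X → Y) (η : ℝ → ℝ) : Prop where
  cont : ContinuousOn η (Set.Ici 0)
  mono : StrictMonoOn η (Set.Ici 0)
  zero : η 0 = 0
  surj : Set.SurjOn η (Set.Ici 0) (Set.Ici 0)
  qs : ∀ x a b : X, x ≠ b →
    dist (f x) (f a) ≤ η (dist x a / dist x b) * dist (f x) (f b)

/-- A two-sided control of distance ratios, invariant under passing to the inverse map. -/
structure ControlsRatios {X Y : Type*} [MetricSpace X] [MetricSpace Y] (f : X → Y) : Prop where
  bounded : ∀ t : ℝ, ∃ T : ℝ, 1 ≤ T ∧ ∀ x a b,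
    dist x a ≤ t * dist x b → dist (f x) (f a) ≤ T * dist (f x) (f b)
  small : ∀ ε : ℝ, 0 < ε → ∃ δ : ℝ, 0 < δ ∧ ∀ x a b,
    dist x a ≤ δ * dist x b → dist (f x) (f a) ≤ ε * dist (f x) (f b)

theorem IsQuasisymmetric.controlsRatios {X Y : Type*} [MetricSpace X] [MetricSpace Y]
    {f : X → Y} {η : ℝ → ℝ} (h : IsQuasisymmetric f η) : ControlsRatios f := by
  have key : ∀ t : ℝ, 0 ≤ t → ∀ x a b, dist x a ≤ t * dist x b →
      dist (f x) (f a) ≤ η t * dist (f x) (f b) := by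
    intro t ht x a b hab
    rcases eq_or_ne x b with rfl | hne
    · have : dist x a ≤ 0 := by simpa using hab
      have hxa : x = a := dist_le_zero.1 this
      subst hxa
      simp
    · have hpos : 0 < dist x b := dist_pos.2 hne
      have hη : η (dist x a / dist x b) ≤ η t :=
        h.mono.monotoneOn (Set.mem_Ici.2 (by positivity)) ht ((div_le_iff₀ hpos).2 hab)
      exact (h.qs x a b hne).trans (mul_le_mul_of_nonneg_right hη dist_nonneg)
  constructor
  · intro t
    refine ⟨max 1 (η (max t 0)), le_max_left _ _, fun x a b hab => ?_⟩
    refine (key (max t 0) (le_max_right _ _) x a b (hab.trans ?_)).trans ?_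
    · exact mul_le_mul_of_nonneg_right (le_max_left _ _) dist_nonneg
    · exact mul_le_mul_of_nonneg_right (le_max_right _ _) dist_nonneg
  · intro ε hε
    obtain ⟨δ, hδ, hδε⟩ := h.surj (Set.mem_Ici.2 hε.le)
    have hδ0 : δ ≠ 0 := by
      rintro rfl
      rw [h.zero] at hδε
      exact hε.ne hδε
    refine ⟨δ, lt_of_le_of_ne hδ hδ0.symm, fun x a b hab => ?_⟩
    rw [← hδε]
    exact key δ hδ x a b hab

theorem ControlsRatios.symm {X Y : Type*} [MetricSpace X] [MetricSpace Y]
    {f : X ≃ₜ Y} (h : ControlsRatios f) : ControlsRatios f.symm := by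
  have key : ∀ {s t : ℝ}, 0 < s → 0 < t →
      (∀ x a b, dist x a ≤ s * dist x b → dist (f x) (f a) ≤ t * dist (f x) (f b)) →
      ∀ y c d, dist y c ≤ (2 * t)⁻¹ * dist y d →
        dist (f.symm y) (f.symm c) ≤ s⁻¹ * dist (f.symm y) (f.symm d) := by
    intro s t hs ht hst y c d hcd
    by_contra! hlt
    have h1 : dist (f.symm y) (f.symm d) ≤ s * dist (f.symm y) (f.symm c) := by
      rw [inv_mul_eq_div, div_lt_iff₀ hs] at hlt
      linarith
    have h2 := hst _ _ _ h1
    simp only [Homeomorph.apply_symm_apply] at h2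
    have h3 : dist y d ≤ (1 / 2) * dist y d := by
      refine h2.trans ((mul_le_mul_of_nonneg_left hcd ht.le).trans_eq ?_)
      field_simp
    have h4 : dist y d = 0 := by linarith [dist_nonneg (x := y) (y := d)]
    have h5 : dist y c ≤ 0 := by simpa [h4] using hcd
    have hyc : y = c := dist_le_zero.1 h5
    subst hyc
    rw [dist_self] at hlt
    exact absurd hlt (not_lt.2 (by positivity))
  constructor
  · intro t
    have ht : 0 < max t 1 := lt_max_of_lt_right one_pos
    obtain ⟨δ, hδ, hδt⟩ := h.small (2 * max t 1)⁻¹ (by positivity)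
    refine ⟨max 1 δ⁻¹, le_max_left _ _, fun y c d hcd => ?_⟩
    refine (key hδ (by positivity) hδt y c d (hcd.trans ?_)).trans ?_
    · refine mul_le_mul_of_nonneg_right ?_ dist_nonneg
      rw [mul_inv, inv_inv, ← mul_assoc]
      norm_num
    · exact mul_le_mul_of_nonneg_right (le_max_right _ _) dist_nonneg
  · intro ε hε
    obtain ⟨T, hT, hTε⟩ := h.bounded ε⁻¹
    refine ⟨(2 * T)⁻¹, by positivity, fun y c d hcd => ?_⟩
    simpa using key (inv_pos.2 hε) (by positivity) hTε y c d hcd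

/-- Nearest-point map onto a maximal `r`-separated subset. -/
theorem exists_separated_projection (X : Type*) [MetricSpace X] {r : ℝ} (hr : 0 < r) :
    ∃ π : X → X, (∀ x, dist x (π x) < r) ∧ ∀ x x', dist (π x) (π x') < r → π x = π x' := by
  obtain ⟨S, hS⟩ := zorn_subset {S : Set X | S.Pairwise fun x y => r ≤ dist x y} (by
    intro c hc hchain
    refine ⟨⋃₀ c, ?_, fun s hs => Set.subset_sUnion_of_mem hs⟩
    exact (Set.pairwise_sUnion hchain.directedOn).2 fun s hs => hc hs)
  have hcov : ∀ x, ∃ y ∈ S, dist x y < r := by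
    intro x
    by_contra! hx
    have hins : insert x S ∈ {S : Set X | S.Pairwise fun x y => r ≤ dist x y} := by
      refine hS.prop.insert fun y hy _ => ⟨hx y hy, ?_⟩
      rw [dist_comm]
      exact hx y hy
    have hxS : x ∈ S := hS.le_of_ge hins (Set.subset_insert x S) (Set.mem_insert x S)
    have := hx x hxS
    rw [dist_self] at this
    linarith
  choose π hπS hπ using hcov
  refine ⟨π, hπ, fun x x' hxx => ?_⟩
  by_contra hne
  exact absurd (hS.prop (hπS x) (hπS x') hne) (not_le.2 hxx)

/-- Ahlfors regular spaces are uniformly perfect. -/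
theorem exists_annulus_point {X : Type*} [MetricSpace X] [MeasurableSpace X]
    (μ : Measure X) {n : ℝ} (hn : 0 < n) {a₁ a₂ : ℝ≥0∞} (ha₁ : 0 < a₁) (ha₂ : a₂ ≠ ∞)
    (hA : ∀ (x : X) (r : ℝ), 0 < r → ENNReal.ofReal r < Metric.ediam (Set.univ : Set X) →
      a₁ * ENNReal.ofReal (r ^ n) ≤ μ (Metric.ball x r) ∧
      μ (Metric.ball x r) ≤ a₂ * ENNReal.ofReal (r ^ n)) :
    ∃ c : ℝ, 0 < c ∧ c ≤ 1 ∧ ∀ (x : X) (R : ℝ), 0 < R →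
      ENNReal.ofReal R < Metric.ediam (Set.univ : Set X) → ∃ b, c * R ≤ dist x b ∧ dist x b < R := by
  obtain ⟨e, he, hea⟩ := ENNReal.exists_nnreal_pos_mul_lt ha₂ ha₁.ne'
  have he' : (0 : ℝ) < e := he
  set c : ℝ := min 1 ((e : ℝ) ^ (1 / n)) with hc
  have hc0 : 0 < c := lt_min one_pos (Real.rpow_pos_of_pos he' _)
  have hcn : c ^ n ≤ e := by
    calc c ^ n ≤ ((e : ℝ) ^ (1 / n)) ^ n := Real.rpow_le_rpow hc0.le (min_le_right _ _) hn.le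
      _ = e := by rw [← Real.rpow_mul he'.le, one_div_mul_cancel hn.ne', Real.rpow_one]
  refine ⟨c, hc0, min_le_left _ _, fun x R hR hRd => ?_⟩
  by_contra! hno
  have hsub : Metric.ball x R ⊆ Metric.ball x (c * R) := by
    intro y hy
    rw [Metric.mem_ball, dist_comm] at hy ⊢
    by_contra! hle
    exact absurd (hno y hle) (not_le.2 hy)
  have hcR : ENNReal.ofReal (c * R) < Metric.ediam (Set.univ : Set X) := by
    refine lt_of_le_of_lt (ENNReal.ofReal_le_ofReal ?_) hRd
    exact mul_le_of_le_one_left hR.le (min_le_left _ _)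
  have h1 := (hA x R hR hRd).1.trans ((measure_mono hsub).trans (hA x (c * R) (by positivity) hcR).2)
  rw [Real.mul_rpow hc0.le hR.le, ENNReal.ofReal_mul (by positivity), ← mul_assoc] at h1
  have hRn : 0 < R ^ n := Real.rpow_pos_of_pos hR n
  have h2 : a₁ ≤ a₂ * ENNReal.ofReal (c ^ n) :=
    (ENNReal.mul_le_mul_iff_left (ENNReal.ofReal_pos.2 hRn).ne' ENNReal.ofReal_ne_top).1 h1
  refine absurd (h2.trans ?_) (not_le.2 hea)
  rw [mul_comm]
  gcongr
  rw [← ENNReal.ofReal_coe_nnreal]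
  exact ENNReal.ofReal_le_ofReal hcn

/-- `ρ` is comparable to `r`, with constant `C`. -/
def Comparable (C ρ r : ℝ) : Prop := r ≤ C * ρ ∧ 2 * ρ ≤ C * r

/-- The dyadic number `2 ^ (-j)` is comparable to `r`, with constant `C`. -/
def DyadicComparable (C r : ℝ) (j : ℤ) : Prop :=
  r ≤ C * (2 : ℝ) ^ (-j) ∧ (2 : ℝ) ^ (-j) ≤ C * r

/-- Balls of radius `2 ^ (-k) / 8` are small compared with the diameter of `X`. -/
def AdmissibleScale (X : Type*) [MetricSpace X] (k : ℤ) : Prop :=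
  ENNReal.ofReal ((2 : ℝ) ^ (-k) / 8) < Metric.ediam (Set.univ : Set X)

theorem two_zpow_neg_succ (k : ℤ) : (2 : ℝ) ^ (-(k + 1)) = (2 : ℝ) ^ (-k) / 2 := by
  rw [neg_add, zpow_add₀ two_ne_zero, zpow_neg_one, div_eq_mul_inv]

theorem AdmissibleScale.of_le {X : Type*} [MetricSpace X] {k l : ℤ} (h : AdmissibleScale X k)
    (hkl : k ≤ l) : AdmissibleScale X l := by
  refine lt_of_le_of_lt (ENNReal.ofReal_le_ofReal ?_) h
  have : (2 : ℝ) ^ (-l) ≤ 2 ^ (-k) := zpow_le_zpow_right₀ one_le_two (neg_le_neg hkl)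
  linarith

theorem AdmissibleScale.of_dist {X : Type*} [MetricSpace X] {k : ℤ} {x y : X}
    (h : (2 : ℝ) ^ (-k - 1) ≤ dist x y) : AdmissibleScale X k := by
  have h0 : (0 : ℝ) < 2 ^ (-k) := by positivity
  have h1 : (2 : ℝ) ^ (-k) / 8 < dist x y := by
    rw [← neg_add', two_zpow_neg_succ] at h
    linarith
  refine lt_of_lt_of_le ?_
    (Metric.edist_le_ediam_of_mem (Set.mem_univ x) (Set.mem_univ y))
  rw [edist_dist]
  exact (ENNReal.ofReal_lt_ofReal_iff (by linarith)).2 h1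

theorem Comparable.of_dist_le {Y : Type*} [MetricSpace Y] {T r : ℝ} (hT : 1 ≤ T) {P Q a b : Y}
    (h₁ : r ≤ T * dist P Q) (h₂ : dist P Q ≤ T * r) (ha : dist a P ≤ dist P Q / 4)
    (hb : dist b Q ≤ dist P Q / 4) : Comparable (4 * T) (dist a b) r := by
  have h3 : dist P Q ≤ dist a P + dist a b + dist b Q := by
    have := dist_triangle4 P a b Q
    rwa [dist_comm P a] at this
  have h4 : dist a b ≤ dist a P + dist P Q + dist b Q := by
    have := dist_triangle4 a P Q b
    rwa [dist_comm Q b] at this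
  constructor
  · have : T * dist P Q ≤ T * (2 * dist a b) := by gcongr; linarith
    have : 0 ≤ T * dist a b := by positivity
    linarith
  · have : 0 ≤ dist P Q := dist_nonneg
    linarith

/-- At every scale `2 ^ (-k)`, a net in `X` together with two distinct nodes for each point `z` of
the net. The images of the nodes in `Y` are separated at the scale `rad k z`, and so are the
images of suitably chosen nodes at neighbouring net points and scales. -/
structure NodeSystem {X Y : Type*} [MetricSpace X] [MetricSpace Y] (f : X → Y) (C : ℝ) (K : ℕ) where
  net : ℤ → X → X
  node : Bool → ℤ → X → X
  rad : ℤ → X → ℝ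
  four_le : 4 ≤ C
  rad_eq : ∀ k z, rad k z = dist (f (node false k z)) (f (node true k z))
  net_dist : ∀ k x, dist x (net k x) < 2 ^ (-k) / 8
  node_dist : ∀ i k z, AdmissibleScale X k → dist z (node i k z) ≤ 2 ^ (-k)
  rad_pos : ∀ k z, AdmissibleScale X k → 0 < rad k z
  card_le : ∀ (y : Y) (j : ℤ) (F : Finset (ℤ × X)),
    (∀ a ∈ F, AdmissibleScale X a.1 ∧ a.2 ∈ Set.range (net a.1) ∧
      dist y (f (node false a.1 a.2)) < 2 * rad a.1 a.2 ∧
      DyadicComparable C (rad a.1 a.2) j) → F.card ≤ K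
  self : ∀ k z, AdmissibleScale X k → ∀ a b, dist a (f (node false k z)) < rad k z / C →
    dist b (f (node true k z)) < rad k z / C → Comparable C (dist a b) (rad k z)
  step : ∀ k x, AdmissibleScale X k → ∃ i, ∀ a b,
    dist a (f (node i k (net k x))) < rad k (net k x) / C →
    dist b (f (node false (k + 1) (net (k + 1) x))) < rad (k + 1) (net (k + 1) x) / C →
    Comparable C (dist a b) (rad k (net k x)) ∧
      Comparable C (dist a b) (rad (k + 1) (net (k + 1) x))
  pair : ∀ k x x', (2 : ℝ) ^ (-k - 1) ≤ dist x x' → dist x x' < 2 ^ (-k) → ∀ a b,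
    dist a (f (node false k (net k x))) < rad k (net k x) / C →
    dist b (f (node false k (net k x'))) < rad k (net k x') / C →
    Comparable C (dist a b) (rad k (net k x)) ∧ Comparable C (dist a b) (rad k (net k x'))
  point : ∀ k x, AdmissibleScale X k → ∃ i, ∀ a,
    dist a (f (node i k (net k x))) < rad k (net k x) / C →
    Comparable C (dist (f x) a) (rad k (net k x))

theorem Finset.card_le_of_sub_lt {K : ℕ} (S : Finset ℤ) (h : ∀ a ∈ S, ∀ b ∈ S, b < a + K) :
    S.card ≤ K := by
  rcases S.eq_empty_or_nonempty with rfl | hne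
  · simp
  · have hsub : S ⊆ Finset.Ico (S.min' hne) (S.min' hne + K) := fun a ha =>
      Finset.mem_Ico.2 ⟨S.min'_le a ha, h _ (S.min'_mem hne) a ha⟩
    simpa using Finset.card_le_card hsub

theorem exists_nodeSystem {X Y : Type*} [MetricSpace X] [MetricSpace Y] {f : X ≃ₜ Y}
    (hf : ControlsRatios f) {c : ℝ} (hc : 0 < c) (hc1 : c ≤ 1)
    (hperf : ∀ (x : X) (R : ℝ), 0 < R →
      ENNReal.ofReal R < Metric.ediam (Set.univ : Set X) →
      ∃ b, c * R ≤ dist x b ∧ dist x b < R) :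
    ∃ (C : ℝ) (K : ℕ), Nonempty (NodeSystem f C K) := by
  obtain ⟨S, hS, hSf⟩ := hf.symm.bounded 2
  set d : ℝ := 1 / (32 * S) with hd
  have hd0 : 0 < d := by positivity
  have hSd : S * d = 1 / 32 := by rw [hd]; field_simp
  have hd1 : d ≤ 1 / 32 := by
    rw [← hSd]; exact le_mul_of_one_le_left hd0.le hS
  set l : ℝ := c * d with hl
  have hl0 : 0 < l := mul_pos hc hd0
  have hl1 : l ≤ 1 / 32 := (mul_le_of_le_one_left hd0.le hc1).trans hd1
  obtain ⟨T, hT, hTf⟩ := hf.bounded (4 / l)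
  obtain ⟨ε, hε, hεf⟩ := hf.small (1 / (12 * (4 * T) ^ 2)) (by positivity)
  obtain ⟨K, hK⟩ := exists_pow_lt_of_lt_one (show 0 < ε * l / 4 by positivity)
    (show (1 / 2 : ℝ) < 1 by norm_num)
  have hpow : ∀ k : ℤ, (0 : ℝ) < 2 ^ (-k) := fun k => by positivity
  have haux : ∀ (k : ℤ) (z : X), ∃ b, AdmissibleScale X k →
      l * 2 ^ (-k) ≤ dist z b ∧ dist z b < d * 2 ^ (-k) := by
    intro k z
    by_cases hk : AdmissibleScale X k
    · obtain ⟨b, hb1, hb2⟩ := hperf z (d * 2 ^ (-k)) (mul_pos hd0 (hpow k))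
        (lt_of_le_of_lt (ENNReal.ofReal_le_ofReal (by nlinarith [hpow k])) hk)
      exact ⟨b, fun _ => ⟨by rw [hl, mul_assoc]; exact hb1, hb2⟩⟩
    · exact ⟨z, fun h => absurd h hk⟩
  choose aux haux using haux
  choose net hnet hsep using fun k : ℤ =>
    exists_separated_projection X (r := 2 ^ (-k) / 8) (by have := hpow k; positivity)
  have ratio : ∀ (q q' p : X) (L : ℝ), 0 < L → l / 2 * L ≤ dist q q' → dist q q' ≤ L →
      l / 2 * L ≤ dist q p → dist q p ≤ 2 * L →
      dist (f q) (f q') ≤ T * dist (f q) (f p) ∧ dist (f q) (f p) ≤ T * dist (f q) (f q') := by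
    intro q q' p L hL h1 h2 h3 h4
    constructor
    · refine hTf q q' p ?_
      rw [div_mul_eq_mul_div, le_div_iff₀ hl0]
      nlinarith
    · refine hTf q p q' ?_
      rw [div_mul_eq_mul_div, le_div_iff₀ hl0]
      nlinarith
  have radlt : ∀ {r D e : ℝ}, r ≤ T * D → e < r / (4 * T) → e ≤ D / 4 := by
    intro r D e h1 h2
    refine h2.le.trans ?_
    rw [div_le_iff₀ (by positivity)]
    linarith
  have far : ∀ k z x, AdmissibleScale X k → dist z x ≤ 2 ^ (-k) →
      ∃ i : Bool, l / 2 * 2 ^ (-k) ≤ dist (bif i then aux k z else z) x ∧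
        dist (bif i then aux k z else z) x ≤ 2 * 2 ^ (-k) := by
    intro k z x hk hzx
    obtain ⟨h1, h2⟩ := haux k z hk
    have hL := hpow k
    have h3 := dist_triangle z x (aux k z)
    have h4 := dist_triangle (aux k z) z x
    rw [dist_comm (aux k z) z] at h4
    rw [dist_comm x] at h3
    by_cases hfar : l / 2 * 2 ^ (-k) ≤ dist z x
    · exact ⟨false, hfar, by simp only [cond_false]; linarith⟩
    · refine ⟨true, ?_, ?_⟩ <;> simp only [cond_true]
      · push Not at hfar
        linarith
      · nlinarith
  have nodes : ∀ i k z p, AdmissibleScale X k →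
      l / 2 * 2 ^ (-k) ≤ dist (bif i then aux k z else z) p →
      dist (bif i then aux k z else z) p ≤ 2 * 2 ^ (-k) →
      dist (f z) (f (aux k z)) ≤ T * dist (f (bif i then aux k z else z)) (f p) ∧
      dist (f (bif i then aux k z else z)) (f p) ≤ T * dist (f z) (f (aux k z)) := by
    intro i k z p hk h1 h2
    obtain ⟨h3, h4⟩ := haux k z hk
    have hL := hpow k
    have h5 : l / 2 * 2 ^ (-k) ≤ dist z (aux k z) := by nlinarith
    have h6 : dist z (aux k z) ≤ 2 ^ (-k) := by nlinarith
    cases i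
    · exact ratio z (aux k z) p _ hL h5 h6 h1 h2
    · have := ratio (aux k z) z p _ hL (by rwa [dist_comm]) (by rwa [dist_comm]) h1 h2
      rwa [dist_comm (f (aux k z)) (f z)] at this
  refine ⟨4 * T, K, ⟨{
    net := net
    node := fun i k z => bif i then aux k z else z
    rad := fun k z => dist (f z) (f (aux k z))
    four_le := by linarith
    rad_eq := fun k z => rfl
    net_dist := hnet
    node_dist := ?_
    rad_pos := ?_
    card_le := ?_
    self := ?_
    step := ?_
    pair := ?_
    point := ?_ }⟩⟩
  · intro i k z hk
    have hL := hpow k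
    cases i
    · simpa using hL.le
    · have := (haux k z hk).2
      simp only [cond_true]
      nlinarith
  · intro k z hk
    have h1 : 0 < dist z (aux k z) := lt_of_lt_of_le (mul_pos hl0 (hpow k)) (haux k z hk).1
    exact dist_pos.2 fun h => (dist_pos.1 h1) (f.injective h)
  · intro y j F hF
    simp only [cond_false] at hF
    have near : ∀ a ∈ F, dist a.2 (f.symm y) ≤ 2 ^ (-a.1) / 32 := by
      intro a ha
      obtain ⟨hk, -, hy, -⟩ := hF a ha
      have h1 := hSf (f a.2) y (f (aux a.1 a.2)) (by rw [dist_comm]; exact hy.le)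
      simp only [Homeomorph.symm_apply_apply] at h1
      have h2 : S * dist a.2 (aux a.1 a.2) ≤ S * (d * 2 ^ (-a.1)) := by
        gcongr
        exact (haux a.1 a.2 hk).2.le
      rw [← mul_assoc, hSd] at h2
      linarith
    have hinj : Set.InjOn Prod.fst (F : Set (ℤ × X)) := by
      rintro ⟨k, z⟩ ha ⟨k', z'⟩ hb hab
      obtain rfl : k = k' := hab
      obtain ⟨x, hx⟩ := (hF _ ha).2.1
      obtain ⟨x', hx'⟩ := (hF _ hb).2.1
      have h1 := near _ ha
      have h2 := near _ hb
      have h3 := dist_triangle_right z z' (f.symm y)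
      have h4 := hpow k
      simp only at hx hx' h1 h2
      subst hx hx'
      rw [hsep k x x' (by linarith)]
    rw [← Finset.card_image_of_injOn hinj]
    refine Finset.card_le_of_sub_lt _ fun k hk k' hk' => ?_
    obtain ⟨⟨k, z⟩, ha, rfl⟩ := Finset.mem_image.1 hk
    obtain ⟨⟨k', z'⟩, hb, rfl⟩ := Finset.mem_image.1 hk'
    have hna := near _ ha
    have hnb := near _ hb
    obtain ⟨hk, -, hy, hj⟩ := hF _ ha
    obtain ⟨hk', -, hy', hj'⟩ := hF _ hb
    simp only at hna hnb hk hy hj hk' hy' hj' ⊢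
    by_contra! hle
    have hL := hpow k
    have hL' := hpow k'
    have hLL : (2 : ℝ) ^ (-k') ≤ (1 / 2) ^ K * 2 ^ (-k) := by
      calc (2 : ℝ) ^ (-k') ≤ 2 ^ (-(k + K)) := zpow_le_zpow_right₀ one_le_two (by lia)
        _ = (1 / 2) ^ K * 2 ^ (-k) := by
          rw [neg_add_rev, zpow_add₀ two_ne_zero, zpow_neg, zpow_natCast, one_div, inv_pow]
    have hLL' : (2 : ℝ) ^ (-k') ≤ ε * l / 4 * 2 ^ (-k) :=
      hLL.trans (mul_le_mul_of_nonneg_right hK.le hL.le)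
    obtain ⟨i, hi, -⟩ := far k z (f.symm y) hk (by linarith)
    set q := bif i then aux k z else z with hq
    have hqr : dist y (f q) ≤ 3 * dist (f z) (f (aux k z)) := by
      have h1 := dist_triangle y (f z) (f (aux k z))
      have h2 : 0 ≤ dist (f z) (f (aux k z)) := dist_nonneg
      cases i <;> simp only [hq, cond_true, cond_false] <;> linarith
    have small : ∀ p, dist (f.symm y) p ≤ 2 * 2 ^ (-k') →
        dist y (f p) ≤ 1 / (12 * (4 * T) ^ 2) * (3 * dist (f z) (f (aux k z))) := by
      intro p hp
      have h1 := hεf (f.symm y) p q (by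
        rw [dist_comm _ q]
        have : ε * (l / 2 * 2 ^ (-k)) ≤ ε * dist q (f.symm y) := by gcongr
        linarith)
      rw [Homeomorph.apply_symm_apply] at h1
      exact h1.trans (by gcongr)
    have h1 := small z' (by rw [dist_comm]; linarith)
    have h2 := small (aux k' z') (by
      have h3 := dist_triangle_left (f.symm y) (aux k' z') z'
      have h4 := (haux k' z' hk').2
      nlinarith)
    have h3 := dist_triangle_left (f z') (f (aux k' z')) y
    have hr : 0 < dist (f z) (f (aux k z)) := by
      have h1 : 0 < dist z (aux k z) := lt_of_lt_of_le (mul_pos hl0 hL) (haux k z hk).1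
      exact dist_pos.2 fun h => (dist_pos.1 h1) (f.injective h)
    have h4 : dist (f z) (f (aux k z)) ≤
        4 * T * (4 * T * (2 * (1 / (12 * (4 * T) ^ 2) * (3 * dist (f z) (f (aux k z)))))) := by
      refine hj.1.trans (mul_le_mul_of_nonneg_left (hj'.2.trans ?_) (by positivity))
      exact mul_le_mul_of_nonneg_left (by linarith) (by positivity)
    have h5 : 4 * T * (4 * T * (2 * (1 / (12 * (4 * T) ^ 2) * (3 * dist (f z) (f (aux k z)))))) =
        dist (f z) (f (aux k z)) / 2 := by
      field_simp
      norm_num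
    linarith
  · intro k z hk a b ha hb
    simp only [cond_true, cond_false] at ha hb
    have h1 : dist (f z) (f (aux k z)) ≤ T * dist (f z) (f (aux k z)) :=
      le_mul_of_one_le_left dist_nonneg hT
    exact Comparable.of_dist_le hT h1 h1 (radlt h1 ha) (radlt h1 hb)
  · intro k x hk
    have hL := hpow k
    have hz := hnet k x
    have hz' := hnet (k + 1) x
    have hk' : AdmissibleScale X (k + 1) := hk.of_le (by lia)
    have h2 := two_zpow_neg_succ k
    obtain ⟨i, h3, h4⟩ := far k (net k x) (net (k + 1) x) hk (by
      have := dist_triangle_left (net k x) (net (k + 1) x) x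
      linarith)
    obtain ⟨h5, h6⟩ := nodes i k _ _ hk h3 h4
    refine ⟨i, fun a b ha hb => ?_⟩
    simp only [cond_false] at hb
    obtain ⟨h7, h8⟩ := haux (k + 1) (net (k + 1) x) hk'
    rw [h2] at h7 h8
    have h9 := ratio (net (k + 1) x) (aux (k + 1) (net (k + 1) x)) _ _ hL (by linarith)
      (by nlinarith) (by rwa [dist_comm]) (by rwa [dist_comm])
    rw [dist_comm (f (net (k + 1) x)) (f (bif i then _ else _))] at h9
    exact ⟨Comparable.of_dist_le hT h5 h6 (radlt h5 ha) (radlt h9.1 hb),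
      Comparable.of_dist_le hT h9.1 h9.2 (radlt h5 ha) (radlt h9.1 hb)⟩
  · intro k x x' h1 h2 a b ha hb
    simp only [cond_false] at ha hb
    have hk : AdmissibleScale X k := .of_dist h1
    have hL := hpow k
    have hz := hnet k x
    have hz' := hnet k x'
    rw [← neg_add', two_zpow_neg_succ] at h1
    have h3 := dist_triangle4 x (net k x) (net k x') x'
    have h4 := dist_triangle4 (net k x) x x' (net k x')
    rw [dist_comm (net k x') x'] at h3
    rw [dist_comm (net k x) x] at h4
    have h5 : l / 2 * 2 ^ (-k) ≤ dist (net k x) (net k x') := by nlinarith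
    have h6 : dist (net k x) (net k x') ≤ 2 * 2 ^ (-k) := by linarith
    have h7 := nodes false k (net k x) (net k x') hk h5 h6
    rw [dist_comm] at h5 h6
    have h8 := nodes false k (net k x') (net k x) hk h5 h6
    simp only [cond_false] at h7 h8
    rw [dist_comm (f (net k x')) (f (net k x))] at h8
    exact ⟨Comparable.of_dist_le hT h7.1 h7.2 (radlt h7.1 ha) (radlt h8.1 hb),
      Comparable.of_dist_le hT h8.1 h8.2 (radlt h7.1 ha) (radlt h8.1 hb)⟩
  · intro k x hk
    have hL := hpow k
    have hz := hnet k x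
    obtain ⟨i, h3, h4⟩ := far k (net k x) x hk (by rw [dist_comm]; linarith)
    obtain ⟨h5, h6⟩ := nodes i k _ _ hk h3 h4
    refine ⟨i, fun a ha => ?_⟩
    rw [dist_comm]
    refine Comparable.of_dist_le hT h5 h6 (radlt h5 ha) ?_
    rw [dist_self]
    positivity

/-- `y` is close to the image of the net point `a.2` at scale `2 ^ (-a.1)`, and `2 ^ (-j)` is
comparable to the size of this image. -/
def NodeSystem.Near {X Y : Type*} [MetricSpace X] [MetricSpace Y] {f : X → Y} {C : ℝ} {K : ℕ}
    (S : NodeSystem f C K) (a : ℤ × X) (y : Y) (j : ℤ) : Prop :=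
  AdmissibleScale X a.1 ∧ a.2 ∈ Set.range (S.net a.1) ∧
    dist y (f (S.node false a.1 a.2)) < 2 * S.rad a.1 a.2 ∧ DyadicComparable C (S.rad a.1 a.2) j

/-- The energy of `g` near the image of the net point `a.2`, at scales comparable to the size of
this image. -/
noncomputable def NodeSystem.mass {X Y : Type*} [MetricSpace X] [MetricSpace Y]
    [MeasurableSpace Y] {f : X → Y} {C : ℝ} {K : ℕ} (S : NodeSystem f C K) (μ : Measure Y)
    (p : ℝ) (g : ℤ → Y → ℝ≥0∞) (a : ℤ × X) : ℝ≥0∞ :=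
  ∫⁻ y, ∑' j, {j | S.Near a y j}.indicator (fun j => g j y ^ p) j ∂μ

theorem NodeSystem.measurable_density {X Y : Type*} [MetricSpace X] [MetricSpace Y]
    [MeasurableSpace Y] [BorelSpace Y] {f : X → Y} {C : ℝ} {K : ℕ} (S : NodeSystem f C K)
    {p : ℝ} {g : ℤ → Y → ℝ≥0∞} (hg : ∀ k, Measurable (g k)) (a : ℤ × X) :
    Measurable fun y => ∑' j, {j | S.Near a y j}.indicator (fun j => g j y ^ p) j := by
  refine Measurable.tsum fun j => ?_
  have : (fun y => {j | S.Near a y j}.indicator (fun j => g j y ^ p) j) =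
      {y | S.Near a y j}.indicator fun y => g j y ^ p := by
    ext y
    simp only [Set.indicator, Set.mem_ofPred_eq]
  rw [this]
  refine ((hg j).pow_const p).indicator ?_
  have hset : {y | S.Near a y j} =
      {_y | AdmissibleScale X a.1 ∧ a.2 ∈ Set.range (S.net a.1) ∧
        DyadicComparable C (S.rad a.1 a.2) j} ∩
      Metric.ball (f (S.node false a.1 a.2)) (2 * S.rad a.1 a.2) := by
    ext y
    simp only [NodeSystem.Near, Set.mem_ofPred_eq, Set.mem_inter_iff, Metric.mem_ball]
    tauto
  rw [hset]
  exact (MeasurableSet.const _).inter Metric.isOpen_ball.measurableSet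

theorem NodeSystem.tsum_mass_le {X Y : Type*} [MetricSpace X] [MetricSpace Y]
    [MeasurableSpace Y] [BorelSpace Y] {f : X → Y} {C : ℝ} {K : ℕ} (S : NodeSystem f C K)
    (μ : Measure Y) {p : ℝ} {g : ℤ → Y → ℝ≥0∞} (hg : ∀ k, Measurable (g k)) :
    ∑' a, S.mass μ p g a ≤ K * ∫⁻ y, ∑' j, g j y ^ p ∂μ := by
  classical
  rw [ENNReal.tsum_eq_iSup_sum]
  refine iSup_le fun F => ?_
  unfold NodeSystem.mass
  rw [← lintegral_finsetSum F fun a _ => S.measurable_density hg a,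
    ← lintegral_const_mul' _ _ (ENNReal.natCast_ne_top K)]
  refine lintegral_mono fun y => ?_
  rw [← Summable.tsum_finsetSum fun _ _ => ENNReal.summable, ← ENNReal.tsum_mul_left]
  refine ENNReal.tsum_le_tsum fun j => ?_
  have h1 : ∑ a ∈ F, {j | S.Near a y j}.indicator (fun j => g j y ^ p) j =
      ∑ a ∈ F.filter fun a => S.Near a y j, g j y ^ p := by
    rw [Finset.sum_filter]
    simp only [Set.indicator, Set.mem_ofPred_eq]
  rw [h1, Finset.sum_const, nsmul_eq_mul]
  gcongr
  exact S.card_le y j _ fun a ha => (Finset.mem_filter.1 ha).2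

/-- In each node ball there is a point, outside a given null set, at which all the relevant `g j`
are bounded by their average. -/
theorem NodeSystem.exists_good_point {X Y : Type*} [MetricSpace X] [MetricSpace Y]
    [MeasurableSpace Y] [BorelSpace Y] {f : X → Y} {C : ℝ} {K : ℕ} (S : NodeSystem f C K)
    (μ : Measure Y) {n : ℝ} {b₁ b₂ : ℝ≥0∞} (hb₁ : 0 < b₁) (hb₂ : b₂ ≠ ∞)
    (hA : ∀ (y : Y) (r : ℝ), 0 < r → ENNReal.ofReal r < Metric.ediam (Set.univ : Set Y) →
      b₁ * ENNReal.ofReal (r ^ n) ≤ μ (Metric.ball y r) ∧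
      μ (Metric.ball y r) ≤ b₂ * ENNReal.ofReal (r ^ n))
    {p : ℝ} {g : ℤ → Y → ℝ≥0∞} (hg : ∀ k, Measurable (g k)) {E : Set Y} (hE : μ E = 0)
    {k : ℤ} (hk : AdmissibleScale X k) {z : X} (hz : z ∈ Set.range (S.net k)) (i : Bool) :
    ∃ y ∉ E, dist y (f (S.node i k z)) < S.rad k z / C ∧
      ∀ j, DyadicComparable C (S.rad k z) j →
        g j y ^ p * (b₁ * ENNReal.ofReal ((S.rad k z / C) ^ n)) ≤ S.mass μ p g (k, z) := by
  have hC := S.four_le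
  have hr := S.rad_pos k z hk
  have hrC : 0 < S.rad k z / C := by positivity
  have hrC' : S.rad k z / C < S.rad k z := div_lt_self hr (by linarith)
  have hd : ENNReal.ofReal (S.rad k z / C) < Metric.ediam (Set.univ : Set Y) := by
    refine lt_of_lt_of_le ?_ (Metric.edist_le_ediam_of_mem
      (Set.mem_univ (f (S.node false k z))) (Set.mem_univ (f (S.node true k z))))
    rw [edist_dist, ← S.rad_eq]
    exact (ENNReal.ofReal_lt_ofReal_iff hr).2 hrC'
  obtain ⟨hlow, hup⟩ := hA (f (S.node i k z)) _ hrC hd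
  set B := Metric.ball (f (S.node i k z)) (S.rad k z / C) with hB
  have hBpos : μ B ≠ 0 := by
    refine (lt_of_lt_of_le ?_ hlow).ne'
    exact ENNReal.mul_pos hb₁.ne' (ENNReal.ofReal_pos.2 (Real.rpow_pos_of_pos hrC n)).ne'
  have hBtop : μ B ≠ ∞ := ne_top_of_le_ne_top (ENNReal.mul_ne_top hb₂ ENNReal.ofReal_ne_top) hup
  have : IsFiniteMeasure (μ.restrict B) := ⟨by simpa using hBtop.lt_top⟩
  have hnull : μ.restrict B (E ∪ Bᶜ) = 0 := by
    refine measure_union_null (nonpos_iff_eq_zero.1 ((Measure.restrict_apply_le _ _).trans hE.le)) ?_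
    rw [Measure.restrict_apply Metric.isOpen_ball.measurableSet.compl, Set.compl_inter_self,
      measure_empty]
  obtain ⟨y, hy, hle⟩ := exists_notMem_null_le_laverage (μ := μ.restrict B)
    (by simpa [Measure.restrict_eq_zero] using hBpos)
    (S.measurable_density (p := p) hg (k, z)).aemeasurable hnull
  rw [Set.mem_union, not_or, Set.notMem_compl_iff] at hy
  refine ⟨y, hy.1, hy.2, fun j hj => ?_⟩
  have hnear : S.Near (k, z) y j := by
    refine ⟨hk, hz, ?_, hj⟩
    have h1 : dist y (f (S.node i k z)) < S.rad k z / C := hy.2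
    have h2 := dist_triangle y (f (S.node i k z)) (f (S.node false k z))
    have h3 : dist (f (S.node i k z)) (f (S.node false k z)) ≤ S.rad k z := by
      cases i
      · simpa using hr.le
      · rw [S.rad_eq, dist_comm]
    linarith
  have h1 : g j y ^ p ≤ ∑' j, {j | S.Near (k, z) y j}.indicator (fun j => g j y ^ p) j := by
    refine le_trans ?_ (ENNReal.le_tsum j)
    rw [Set.indicator_of_mem (show j ∈ {j | S.Near (k, z) y j} from hnear)]
  rw [laverage_eq, Measure.restrict_apply_univ] at hle
  calc g j y ^ p * (b₁ * ENNReal.ofReal ((S.rad k z / C) ^ n))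
      ≤ (∫⁻ y in B, ∑' j, {j | S.Near (k, z) y j}.indicator (fun j => g j y ^ p) j ∂μ) / μ B
        * μ B := mul_le_mul' (h1.trans hle) hlow
    _ ≤ ∫⁻ y in B, ∑' j, {j | S.Near (k, z) y j}.indicator (fun j => g j y ^ p) j ∂μ :=
        (ENNReal.div_mul_cancel hBpos hBtop).le
    _ ≤ S.mass μ p g (k, z) := setLIntegral_le_lintegral _ _

theorem exists_dyadic_scale {ρ : ℝ} (hρ : 0 < ρ) :
    ∃ j : ℤ, (2 : ℝ) ^ (-j - 1) ≤ ρ ∧ ρ < (2 : ℝ) ^ (-j) := by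
  obtain ⟨m, hm1, hm2⟩ := _root_.exists_mem_Ico_zpow hρ one_lt_two
  refine ⟨-(m + 1), ?_, ?_⟩
  · rwa [neg_neg, add_sub_cancel_right]
  · rwa [neg_neg]

theorem Comparable.dyadic {C ρ r : ℝ} (hC : 0 ≤ C) (h : Comparable C ρ r) {j : ℤ}
    (h₁ : (2 : ℝ) ^ (-j - 1) ≤ ρ) (h₂ : ρ < (2 : ℝ) ^ (-j)) : DyadicComparable C r j := by
  rw [← neg_add', two_zpow_neg_succ] at h₁
  exact ⟨h.1.trans (by gcongr), by linarith [h.2]⟩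

theorem ofReal_rpow_mul_le_of_mean {C r ρ s p : ℝ} (hC : 0 < C) (hr : 0 < r) (hρ : 0 ≤ ρ)
    (hρr : 2 * ρ ≤ C * r) (hs : 0 < s) (hp : 0 < p) {b x M : ℝ≥0∞} (hb : b ≠ 0) (hM : M ≠ ∞)
    (h : x ^ p * (b * ENNReal.ofReal ((r / C) ^ (s * p))) ≤ M) :
    ENNReal.ofReal (ρ ^ s) * x ≤ (ENNReal.ofReal ((C ^ 2) ^ (s * p)) / b) ^ p⁻¹ * M ^ p⁻¹ := by
  have h1 : x ^ p * ENNReal.ofReal ((r / C) ^ (s * p)) ≤ M / b := by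
    rw [ENNReal.le_div_iff_mul_le (Or.inl hb) (Or.inr hM)]
    calc _ = x ^ p * (b * ENNReal.ofReal ((r / C) ^ (s * p))) := by ring
      _ ≤ M := h
  rw [← ENNReal.mul_rpow_of_nonneg _ _ (inv_nonneg.2 hp.le), ENNReal.le_rpow_inv_iff hp,
    ENNReal.mul_rpow_of_nonneg _ _ hp.le, ENNReal.ofReal_rpow_of_nonneg (by positivity) hp.le,
    ← Real.rpow_mul hρ]
  have h2 : ρ ^ (s * p) ≤ (C ^ 2) ^ (s * p) * (r / C) ^ (s * p) := by
    rw [← Real.mul_rpow (by positivity) (by positivity)]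
    refine Real.rpow_le_rpow hρ ?_ (by positivity)
    have : C ^ 2 * (r / C) = C * r := by field_simp
    linarith
  calc ENNReal.ofReal (ρ ^ (s * p)) * x ^ p
      ≤ ENNReal.ofReal ((C ^ 2) ^ (s * p) * (r / C) ^ (s * p)) * x ^ p := by gcongr
    _ = ENNReal.ofReal ((C ^ 2) ^ (s * p)) * (x ^ p * ENNReal.ofReal ((r / C) ^ (s * p))) := by
        rw [ENNReal.ofReal_mul (by positivity)]
        ring
    _ ≤ ENNReal.ofReal ((C ^ 2) ^ (s * p)) * (M / b) := by gcongr
    _ = ENNReal.ofReal ((C ^ 2) ^ (s * p)) / b * M := by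
        simp only [div_eq_mul_inv]
        ring

theorem ENNReal.tsum_tsum_pow_mul_rpow_le {p : ℝ} (hp : 1 ≤ p) (θ : ℝ≥0∞) (t : ℤ → ℝ≥0∞) :
    ∑' k : ℤ, (∑' i : ℕ, θ ^ i * t (k + i)) ^ p ≤
      (1 - θ)⁻¹ ^ (p - 1) * (1 - θ)⁻¹ * ∑' k, t k ^ p := by
  have hp0 : 0 < p := by linarith
  have key : ∀ k : ℤ, (∑' i : ℕ, θ ^ i * t (k + i)) ^ p ≤
      (1 - θ)⁻¹ ^ (p - 1) * ∑' i : ℕ, θ ^ i * t (k + i) ^ p := by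
    intro k
    rw [← ENNReal.le_rpow_inv_iff hp0]
    refine ENNReal.tsum_le_of_sum_range_le fun N => ?_
    refine (ENNReal.inner_le_weight_mul_Lp_of_nonneg _ hp _ _).trans ?_
    rw [ENNReal.mul_rpow_of_nonneg _ _ (inv_nonneg.2 hp0.le), ← ENNReal.rpow_mul]
    have h1 : (p - 1) * p⁻¹ = 1 - p⁻¹ := by field_simp
    have h2 : 0 ≤ 1 - p⁻¹ := sub_nonneg.2 (inv_le_one_of_one_le₀ hp)
    rw [h1, ← ENNReal.tsum_geometric]
    gcongr <;> exact ENNReal.sum_le_tsum _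
  refine (ENNReal.tsum_le_tsum key).trans_eq ?_
  rw [ENNReal.tsum_mul_left, ENNReal.tsum_comm, mul_assoc, ← ENNReal.tsum_geometric θ,
    ← ENNReal.tsum_mul_right]
  congr 1
  refine tsum_congr fun i => ?_
  rw [ENNReal.tsum_mul_left]
  congr 1
  exact (Equiv.addRight (i : ℤ)).tsum_eq fun k => t k ^ p

theorem tsum_indicator_eq_tsum_support {X : Type*} (m : X → ℝ≥0∞) (B : X → Set X) (x : X) :
    ∑' z, (B z).indicator (fun _ => m z) x =
      ∑' z : Function.support m, (B z).indicator (fun _ => m z) x := by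
  refine (tsum_subtype_eq_of_support_subset
    (f := fun z => (B z).indicator (fun _ => m z) x) fun z hz => ?_).symm
  contrapose! hz
  simp only [Function.mem_support, not_not] at hz ⊢
  simp [hz]

theorem measurable_tsum_indicator {X : Type*} [MeasurableSpace X] {m : X → ℝ≥0∞}
    (hm : ∑' z, m z ≠ ∞) {B : X → Set X} (hB : ∀ z, MeasurableSet (B z)) :
    Measurable fun x => ∑' z, (B z).indicator (fun _ => m z) x := by
  have := (Summable.countable_support_ennreal hm).to_subtype
  simp_rw [tsum_indicator_eq_tsum_support]
  exact Measurable.tsum fun z => measurable_const.indicator (hB z)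

theorem lintegral_tsum_indicator {X : Type*} [MeasurableSpace X] (μ : Measure X) {m : X → ℝ≥0∞}
    (hm : ∑' z, m z ≠ ∞) {B : X → Set X} (hB : ∀ z, MeasurableSet (B z)) :
    ∫⁻ x, ∑' z, (B z).indicator (fun _ => m z) x ∂μ = ∑' z, m z * μ (B z) := by
  have := (Summable.countable_support_ennreal hm).to_subtype
  simp_rw [tsum_indicator_eq_tsum_support]
  rw [lintegral_tsum fun z : Function.support m => (measurable_const.indicator (hB z)).aemeasurable]
  simp_rw [lintegral_indicator_const (hB _)]
  refine tsum_subtype_eq_of_support_subset (f := fun z => m z * μ (B z)) fun z hz => ?_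
  contrapose! hz
  simp only [Function.mem_support, not_not] at hz ⊢
  simp [hz]

theorem Filter.tendsto_int_atTop_iff {α : Type*} {a : ℤ → α} {l : Filter α} (k : ℤ) :
    Filter.Tendsto (fun m : ℕ => a (k + m)) Filter.atTop l ↔ Filter.Tendsto a Filter.atTop l := by
  have h : Filter.map (fun m : ℕ => k + (m : ℤ)) Filter.atTop = Filter.atTop := by
    have : (fun m : ℕ => k + (m : ℤ)) = (OrderIso.addLeft k) ∘ ((↑) : ℕ → ℤ) := rfl
    rw [this, ← Filter.map_map, Nat.map_cast_int_atTop]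
    exact (OrderIso.addLeft k).map_atTop
  rw [← h]
  exact Filter.tendsto_map'_iff.symm

theorem ofReal_abs_sub_eq_edist (a b : ℝ) : ENNReal.ofReal |a - b| = edist a b := by
  rw [edist_dist, Real.dist_eq]

/-- If the increments of a sequence indexed by `ℤ` are controlled by `A`, then its distance to the
limit is controlled by the tail sum of `A`. -/
theorem edist_limUnder_le {a : ℤ → ℝ} {A : ℤ → ℝ≥0∞} {k : ℤ}
    (h : ∀ j, k ≤ j → edist (a j) (a (j + 1)) ≤ 3 * (A j + A (j + 1))) :
    edist (a k) (Filter.limUnder Filter.atTop a) ≤ 6 * ∑' i : ℕ, A (k + i) := by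
  by_cases hfin : ∑' i : ℕ, A (k + i) = ∞
  · rw [hfin]
    simp
  have hsucc : ∑' i : ℕ, A (k + i + 1) ≤ ∑' i : ℕ, A (k + i) := by
    have := ENNReal.tsum_comp_le_tsum_of_injective Nat.succ_injective fun i : ℕ => A (k + i)
    refine le_trans (le_of_eq (tsum_congr fun i => ?_)) this
    congr 1
    push_cast
    ring
  have hsum : ∑' i : ℕ, 3 * (A (k + i) + A (k + i + 1)) ≤ 6 * ∑' i : ℕ, A (k + i) := by
    rw [ENNReal.tsum_mul_left, ENNReal.tsum_add]
    calc 3 * (∑' i : ℕ, A (k + i) + ∑' i : ℕ, A (k + i + 1))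
        ≤ 3 * (∑' i : ℕ, A (k + i) + ∑' i : ℕ, A (k + i)) := by gcongr
      _ = 6 * ∑' i : ℕ, A (k + i) := by ring
  have hinc : ∀ m : ℕ, edist (a (k + m)) (a (k + m.succ)) ≤ 3 * (A (k + m) + A (k + m + 1)) := by
    intro m
    have := h (k + m) (by lia)
    rwa [Nat.cast_succ, ← add_assoc]
  have hcau : CauchySeq fun m : ℕ => a (k + m) :=
    cauchySeq_of_edist_le_of_tsum_ne_top _ hinc
      (ne_top_of_le_ne_top (ENNReal.mul_ne_top (by simp) hfin) hsum)
  obtain ⟨L, hL⟩ := cauchySeq_tendsto_of_complete hcau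
  have hL' : Filter.limUnder Filter.atTop a = L := ((Filter.tendsto_int_atTop_iff k).1 hL).limUnder_eq
  have := edist_le_tsum_of_edist_le_of_tendsto _ hinc hL 0
  simp only [Nat.cast_zero, add_zero, zero_add] at this
  rw [hL']
  exact this.trans hsum

theorem NodeSystem.exists_representative {X Y : Type*} [MetricSpace X] [MetricSpace Y]
    [MeasurableSpace Y] [BorelSpace Y] {f : X ≃ₜ Y} {C : ℝ} {K : ℕ} (S : NodeSystem (⇑f) C K)
    (μ : Measure Y) {s p : ℝ} (hs : 0 < s) (hp : 0 < p) {b₁ b₂ : ℝ≥0∞}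
    (hb₁ : 0 < b₁) (hb₂ : b₂ ≠ ∞)
    (hA : ∀ (y : Y) (r : ℝ), 0 < r → ENNReal.ofReal r < Metric.ediam (Set.univ : Set Y) →
      b₁ * ENNReal.ofReal (r ^ (s * p)) ≤ μ (Metric.ball y r) ∧
      μ (Metric.ball y r) ≤ b₂ * ENNReal.ofReal (r ^ (s * p)))
    (hadm : ∃ k, AdmissibleScale X k)
    {u : Y → ℝ} {g : ℤ → Y → ℝ≥0∞} (hg : IsFracHajlaszGradient μ s u g)
    (hfin : ∫⁻ y, ∑' j, g j y ^ p ∂μ ≠ ∞) :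
    ∃ v : Y → ℝ, v =ᵐ[μ] u ∧
      ∀ (k : ℤ) (x x' : X), (2 : ℝ) ^ (-k - 1) ≤ dist x x' → dist x x' < 2 ^ (-k) →
        edist (v (f x)) (v (f x')) ≤ 7 * (ENNReal.ofReal ((C ^ 2) ^ (s * p)) / b₁) ^ p⁻¹ *
          (∑' i : ℕ, S.mass μ p g (k + i, S.net (k + i) x) ^ p⁻¹ +
            ∑' i : ℕ, S.mass μ p g (k + i, S.net (k + i) x') ^ p⁻¹) := by
  obtain ⟨hgm, E, hE, hgE⟩ := hg
  have hC4 := S.four_le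
  have hC : 0 < C := by linarith
  set c : ℝ≥0∞ := (ENNReal.ofReal ((C ^ 2) ^ (s * p)) / b₁) ^ p⁻¹ with hc
  have hctop : c ≠ ∞ :=
    ENNReal.rpow_ne_top_of_nonneg (inv_nonneg.2 hp.le)
      (ENNReal.div_ne_top ENNReal.ofReal_ne_top hb₁.ne')
  have hmass : ∑' a, S.mass μ p g a ≠ ∞ :=
    ne_top_of_le_ne_top (ENNReal.mul_ne_top (ENNReal.natCast_ne_top K) hfin)
      (S.tsum_mass_le μ hgm)
  have hmass1 : ∀ a, S.mass μ p g a ≠ ∞ := ENNReal.ne_top_of_tsum_ne_top hmass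
  have hpt : ∀ (i : Bool) (k : ℤ) (z : X), ∃ y, AdmissibleScale X k → z ∈ Set.range (S.net k) →
      y ∉ E ∧ dist y (f (S.node i k z)) < S.rad k z / C ∧
      ∀ j, DyadicComparable C (S.rad k z) j → ∀ ρ, 0 ≤ ρ → 2 * ρ ≤ C * S.rad k z →
        ENNReal.ofReal (ρ ^ s) * g j y ≤ c * S.mass μ p g (k, z) ^ p⁻¹ := by
    intro i k z
    by_cases h : AdmissibleScale X k ∧ z ∈ Set.range (S.net k)
    · obtain ⟨y, hyE, hyd, hy⟩ := S.exists_good_point μ hb₁ hb₂ hA (p := p) hgm hE h.1 h.2 i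
      exact ⟨y, fun hk _ => ⟨hyE, hyd, fun j hj ρ hρ hρr =>
        ofReal_rpow_mul_le_of_mean hC (S.rad_pos _ _ hk) hρ hρr hs hp hb₁.ne' (hmass1 _)
          (hy j hj)⟩⟩
    · exact ⟨f z, fun hk hz => absurd ⟨hk, hz⟩ h⟩
  choose P hP using hpt
  replace hP := fun i k x hk => hP i k (S.net k x) hk (Set.mem_range_self x)
  set w : Bool → ℤ → X → ℝ := fun i k x => u (P i k (S.net k x)) with hw
  set A : ℤ → X → ℝ≥0∞ := fun k x => c * S.mass μ p g (k, S.net k x) ^ p⁻¹ with hAdef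
  have hcompare : ∀ i k x i' k' x', AdmissibleScale X k → AdmissibleScale X k' →
      Comparable C (dist (P i k (S.net k x)) (P i' k' (S.net k' x'))) (S.rad k (S.net k x)) →
      Comparable C (dist (P i k (S.net k x)) (P i' k' (S.net k' x'))) (S.rad k' (S.net k' x')) →
      edist (w i k x) (w i' k' x') ≤ A k x + A k' x' := by
    intro i k x i' k' x' hk hk' h1 h2
    obtain ⟨hyE, -, hy⟩ := hP i k x hk
    obtain ⟨hyE', -, hy'⟩ := hP i' k' x' hk'
    have hρ : 0 < dist (P i k (S.net k x)) (P i' k' (S.net k' x')) :=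
      pos_of_mul_pos_right ((S.rad_pos _ _ hk).trans_le h1.1) hC.le
    obtain ⟨j, hj1, hj2⟩ := exists_dyadic_scale hρ
    rw [← ofReal_abs_sub_eq_edist]
    refine (hgE j _ hyE _ hyE' hj1 hj2).trans ?_
    rw [mul_add]
    exact add_le_add (hy j (h1.dyadic hC.le hj1 hj2) _ hρ.le h1.2)
      (hy' j (h2.dyadic hC.le hj1 hj2) _ hρ.le h2.2)
  have hself : ∀ i k x, AdmissibleScale X k →
      edist (w i k x) (w false k x) ≤ A k x + A k x := by
    intro i k x hk
    cases i
    · simp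
    · have h1 := S.self k (S.net k x) hk _ _ (hP false k x hk).2.1 (hP true k x hk).2.1
      rw [edist_comm]
      exact hcompare _ _ _ _ _ _ hk hk h1 h1
  have hstep : ∀ k x, AdmissibleScale X k →
      edist (w false k x) (w false (k + 1) x) ≤ 3 * (A k x + A (k + 1) x) := by
    intro k x hk
    have hk' : AdmissibleScale X (k + 1) := hk.of_le (by lia)
    obtain ⟨i, hi⟩ := S.step k x hk
    obtain ⟨h1, h2⟩ := hi _ _ (hP i k x hk).2.1 (hP false (k + 1) x hk').2.1
    have h3 := hself i k x hk
    rw [edist_comm] at h3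
    calc edist (w false k x) (w false (k + 1) x)
        ≤ edist (w false k x) (w i k x) + edist (w i k x) (w false (k + 1) x) :=
          edist_triangle _ _ _
      _ ≤ (A k x + A k x) + (A k x + A (k + 1) x) :=
          add_le_add h3 (hcompare _ _ _ _ _ _ hk hk' h1 h2)
      _ = 3 * A k x + A (k + 1) x := by ring
      _ ≤ 3 * A k x + 3 * A (k + 1) x := by
          gcongr
          exact le_mul_of_one_le_left' (by norm_num)
      _ = 3 * (A k x + A (k + 1) x) := by ring
  refine ⟨fun y => Filter.limUnder Filter.atTop fun k : ℤ => w false k (f.symm y), ?_, ?_⟩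
  · have hfin' := ae_lt_top (Measurable.tsum fun j => (hgm j).pow_const p) hfin
    have hE' : ∀ᵐ y ∂μ, y ∉ E := measure_eq_zero_iff_ae_notMem.1 hE
    filter_upwards [hfin', hE'] with y hyfin hyE
    obtain ⟨x, rfl⟩ := f.surjective y
    simp only [Homeomorph.symm_apply_apply]
    obtain ⟨k₀, hk₀⟩ := hadm
    refine Filter.Tendsto.limUnder_eq ?_
    rw [← Filter.tendsto_int_atTop_iff k₀, tendsto_iff_edist_tendsto_0]
    have hAlim : Filter.Tendsto (fun m : ℕ => A (k₀ + m) x) Filter.atTop (nhds 0) := by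
      have hinj : Function.Injective fun m : ℕ => (k₀ + (m : ℤ), S.net (k₀ + m) x) := by
        intro m m' h
        have := congrArg Prod.fst h
        simp only at this
        lia
      have h1 := ENNReal.tendsto_atTop_zero_of_tsum_ne_top (ne_top_of_le_ne_top hmass
        (ENNReal.tsum_comp_le_tsum_of_injective hinj (S.mass μ p g)))
      have h2 := h1.ennrpow_const p⁻¹
      rw [ENNReal.zero_rpow_of_pos (inv_pos.2 hp)] at h2
      have h3 := ENNReal.Tendsto.const_mul (a := c) h2 (Or.inr hctop)
      rwa [mul_zero] at h3
    have hrlim : Filter.Tendsto (fun m : ℕ => S.rad (k₀ + m) (S.net (k₀ + m) x)) Filter.atTop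
        (nhds 0) := by
      have hnode : ∀ i, Filter.Tendsto
          (fun m : ℕ => S.node i (k₀ + m) (S.net (k₀ + m) x)) Filter.atTop (nhds x) := by
        intro i
        rw [tendsto_iff_dist_tendsto_zero]
        have hpow : Filter.Tendsto (fun m : ℕ => 2 * (2 : ℝ) ^ (-k₀) * (1 / 2) ^ m)
            Filter.atTop (nhds 0) := by
          have := (tendsto_pow_atTop_nhds_zero_of_lt_one (r := (1 / 2 : ℝ)) (by norm_num)
            (by norm_num)).const_mul (2 * (2 : ℝ) ^ (-k₀))
          rwa [mul_zero] at this
        refine squeeze_zero (fun _ => dist_nonneg) (fun m => ?_) hpow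
        have h1 := S.node_dist i (k₀ + m) (S.net (k₀ + m) x) (hk₀.of_le (by lia))
        have h2 := S.net_dist (k₀ + m) x
        have h3 := dist_triangle_left (S.node i (k₀ + m) (S.net (k₀ + m) x)) x
          (S.net (k₀ + m) x)
        have h4 : (2 : ℝ) ^ (-(k₀ + (m : ℤ))) = 2 ^ (-k₀) * (1 / 2) ^ m := by
          rw [neg_add, zpow_add₀ two_ne_zero, zpow_neg _ (m : ℤ), zpow_natCast, one_div, inv_pow]
        have h5 : (0 : ℝ) < 2 ^ (-(k₀ + (m : ℤ))) := by positivity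
        rw [dist_comm x] at h2
        rw [mul_assoc, ← h4]
        linarith
      simp_rw [S.rad_eq]
      have := ((f.continuous.tendsto x).comp (hnode false)).dist
        ((f.continuous.tendsto x).comp (hnode true))
      rwa [dist_self] at this
    set H : ℝ≥0∞ := (∑' j, g j (f x) ^ p) ^ p⁻¹ with hH
    have hHtop : H ≠ ∞ := ENNReal.rpow_ne_top_of_nonneg (inv_nonneg.2 hp.le) hyfin.ne
    have hbound : ∀ m : ℕ, edist (w false (k₀ + m) x) (u (f x)) ≤
        3 * A (k₀ + m) x +
          ENNReal.ofReal ((C * S.rad (k₀ + m) (S.net (k₀ + m) x)) ^ s) * H := by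
      intro m
      have hk : AdmissibleScale X (k₀ + m) := hk₀.of_le (by lia)
      set k := k₀ + (m : ℤ)
      obtain ⟨i, hi⟩ := S.point k x hk
      obtain ⟨hPE, hPd, hPg⟩ := hP i k x hk
      have h1 := hi _ hPd
      have hρ : 0 < dist (f x) (P i k (S.net k x)) :=
        pos_of_mul_pos_right ((S.rad_pos _ _ hk).trans_le h1.1) hC.le
      obtain ⟨j, hj1, hj2⟩ := exists_dyadic_scale hρ
      have h2 := hgE j _ hyE _ hPE hj1 hj2
      rw [ofReal_abs_sub_eq_edist, mul_add] at h2
      have h3 : ENNReal.ofReal (dist (f x) (P i k (S.net k x)) ^ s) * g j (f x) ≤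
          ENNReal.ofReal ((C * S.rad k (S.net k x)) ^ s) * H := by
        gcongr
        · linarith [h1.2]
        · rw [hH, ENNReal.le_rpow_inv_iff hp]
          exact ENNReal.le_tsum j
      have h4 := hPg j (h1.dyadic hC.le hj1 hj2) _ hρ.le h1.2
      have h5 := hself i k x hk
      rw [edist_comm] at h2 h5
      calc edist (w false k x) (u (f x))
          ≤ edist (w false k x) (w i k x) + edist (w i k x) (u (f x)) := edist_triangle _ _ _
        _ ≤ (A k x + A k x) + (ENNReal.ofReal ((C * S.rad k (S.net k x)) ^ s) * H + A k x) :=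
            add_le_add h5 (h2.trans (add_le_add h3 h4))
        _ = _ := by ring
    refine tendsto_of_tendsto_of_tendsto_of_le_of_le tendsto_const_nhds ?_ (fun _ => zero_le)
      hbound
    have h1 := ENNReal.Tendsto.const_mul (a := 3) hAlim (Or.inr (by simp))
    have h2 := (hrlim.const_mul C).rpow_const (p := s) (Or.inr hs.le)
    rw [mul_zero, Real.zero_rpow hs.ne'] at h2
    have h3 := ENNReal.Tendsto.mul_const (b := H) (ENNReal.tendsto_ofReal h2) (Or.inr hHtop)
    rw [ENNReal.ofReal_zero, zero_mul] at h3
    rw [mul_zero] at h1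
    simpa using h1.add h3
  · intro k x x' h1 h2
    have hk : AdmissibleScale X k := .of_dist h1
    obtain ⟨h3, h4⟩ := S.pair k x x' h1 h2 _ _ (hP false k x hk).2.1 (hP false k x' hk).2.1
    have h5 := hcompare _ _ _ _ _ _ hk hk h3 h4
    have hlim : ∀ x, edist (w false k x) (Filter.limUnder Filter.atTop fun k => w false k x) ≤
        6 * ∑' i : ℕ, A (k + i) x := fun x =>
      edist_limUnder_le (a := fun k => w false k x) (A := fun k => A k x)
        fun j hj => hstep j x (hk.of_le hj)
    have hfirst : ∀ x, A k x ≤ ∑' i : ℕ, A (k + i) x := by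
      intro x
      have := ENNReal.le_tsum (f := fun i : ℕ => A (k + i) x) 0
      simpa using this
    simp only [Homeomorph.symm_apply_apply]
    have h6 := hlim x
    rw [edist_comm] at h6
    calc edist (Filter.limUnder Filter.atTop fun k => w false k x)
          (Filter.limUnder Filter.atTop fun k => w false k x')
        ≤ _ + _ + _ := edist_triangle4 _ (w false k x) (w false k x') _
      _ ≤ 6 * ∑' i : ℕ, A (k + i) x + (A k x + A k x') + 6 * ∑' i : ℕ, A (k + i) x' :=
          add_le_add (add_le_add h6 h5) (hlim x')
      _ ≤ 6 * ∑' i : ℕ, A (k + i) x + (∑' i : ℕ, A (k + i) x + ∑' i : ℕ, A (k + i) x') +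
          6 * ∑' i : ℕ, A (k + i) x' := by
          gcongr
          · exact hfirst x
          · exact hfirst x'
      _ = 7 * c * (∑' i : ℕ, S.mass μ p g (k + i, S.net (k + i) x) ^ p⁻¹ +
            ∑' i : ℕ, S.mass μ p g (k + i, S.net (k + i) x') ^ p⁻¹) := by
          simp only [hAdef, ENNReal.tsum_mul_left]
          ring

theorem NodeSystem.exists_gradient {X Y : Type*} [MetricSpace X] [MeasurableSpace X] [BorelSpace X]
    [MetricSpace Y] [MeasurableSpace Y] [BorelSpace Y] {f : X ≃ₜ Y} {C : ℝ} {K : ℕ}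
    (S : NodeSystem (⇑f) C K) (ν : Measure X) (μ : Measure Y) {s₁ s₂ p : ℝ} (hs₁ : 0 < s₁)
    (hs₂ : 0 < s₂) (hp : 1 ≤ p) {a₂ b₁ b₂ : ℝ≥0∞} (ha₂ : a₂ ≠ ∞) (hb₁ : 0 < b₁) (hb₂ : b₂ ≠ ∞)
    (hAX : ∀ (x : X) (r : ℝ), 0 < r → ENNReal.ofReal r < Metric.ediam (Set.univ : Set X) →
      ν (Metric.ball x r) ≤ a₂ * ENNReal.ofReal (r ^ (s₁ * p)))
    (hAY : ∀ (y : Y) (r : ℝ), 0 < r → ENNReal.ofReal r < Metric.ediam (Set.univ : Set Y) →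
      b₁ * ENNReal.ofReal (r ^ (s₂ * p)) ≤ μ (Metric.ball y r) ∧
      μ (Metric.ball y r) ≤ b₂ * ENNReal.ofReal (r ^ (s₂ * p)))
    (hadm : ∃ k, AdmissibleScale X k) :
    ∃ c : ℝ≥0∞, c ≠ ∞ ∧ ∀ (u : Y → ℝ) (g : ℤ → Y → ℝ≥0∞), IsFracHajlaszGradient μ s₂ u g →
      ∫⁻ y, ∑' j, g j y ^ p ∂μ ≠ ∞ →
      ∃ v : Y → ℝ, v =ᵐ[μ] u ∧ ∃ G : ℤ → X → ℝ≥0∞, IsFracHajlaszGradient ν s₁ (v ∘ f) G ∧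
        ∫⁻ x, ∑' j, G j x ^ p ∂ν ≤ c * ∫⁻ y, ∑' j, g j y ^ p ∂μ := by
  have hp0 : 0 < p := by linarith
  have htwo : ∀ k : ℤ, (0 : ℝ) < 2 ^ k := fun k => by positivity
  set c : ℝ≥0∞ := (ENNReal.ofReal ((C ^ 2) ^ (s₂ * p)) / b₁) ^ p⁻¹ with hc
  have hctop : c ≠ ∞ :=
    ENNReal.rpow_ne_top_of_nonneg (inv_nonneg.2 hp0.le)
      (ENNReal.div_ne_top ENNReal.ofReal_ne_top hb₁.ne')
  set θ : ℝ≥0∞ := ENNReal.ofReal ((1 / 2) ^ s₁) with hθ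
  have hθ1 : θ < 1 := by
    rw [hθ, ENNReal.ofReal_lt_one]
    exact Real.rpow_lt_one (by norm_num) (by norm_num) hs₁
  have hθinv : (1 - θ)⁻¹ ≠ ∞ := ENNReal.inv_ne_top.2 (tsub_pos_of_lt hθ1).ne'
  set D : ℝ≥0∞ := 7 * c * ENNReal.ofReal (2 ^ s₁) with hD
  have hDtop : D ≠ ∞ :=
    ENNReal.mul_ne_top (ENNReal.mul_ne_top (by simp) hctop) ENNReal.ofReal_ne_top
  refine ⟨D ^ p * ((1 - θ)⁻¹ ^ (p - 1) * (1 - θ)⁻¹) * (a₂ * K), ?_, fun u g hg hfin => ?_⟩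
  · exact ENNReal.mul_ne_top (ENNReal.mul_ne_top (ENNReal.rpow_ne_top_of_nonneg hp0.le hDtop)
      (ENNReal.mul_ne_top (ENNReal.rpow_ne_top_of_nonneg (by linarith) hθinv) hθinv))
      (ENNReal.mul_ne_top ha₂ (ENNReal.natCast_ne_top K))
  obtain ⟨v, hvu, hv⟩ := S.exists_representative μ hs₂ hp0 hb₁ hb₂ hAY hadm hg hfin
  refine ⟨v, hvu, ?_⟩
  have htot := S.tsum_mass_le μ (p := p) hg.1
  have hmass : ∑' a, S.mass μ p g a ≠ ∞ :=
    ne_top_of_le_ne_top (ENNReal.mul_ne_top (ENNReal.natCast_ne_top K) hfin) htot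
  have hprod : ∑' a, S.mass μ p g a = ∑' j, ∑' z, S.mass μ p g (j, z) :=
    ENNReal.tsum_prod (f := fun j z => S.mass μ p g (j, z))
  rw [hprod] at hmass htot
  have hmassj : ∀ j, ∑' z, S.mass μ p g (j, z) ≠ ∞ := ENNReal.ne_top_of_tsum_ne_top hmass
  set B : ℤ → X → Set X := fun j z => Metric.ball z (2 ^ (-j) / 8) with hBdef
  have hB : ∀ j z, MeasurableSet (B j z) := fun j z => Metric.isOpen_ball.measurableSet
  set M : ℤ → X → ℝ≥0∞ := fun j x => ∑' z, (B j z).indicator (fun _ => S.mass μ p g (j, z)) x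
    with hM
  have hMmeas : ∀ j, Measurable (M j) := fun j => measurable_tsum_indicator (hmassj j) (hB j)
  have hmassM : ∀ j x, S.mass μ p g (j, S.net j x) ≤ M j x := by
    intro j x
    refine le_trans ?_ (ENNReal.le_tsum (S.net j x))
    rw [Set.indicator_of_mem]
    exact S.net_dist j x
  set t : ℤ → X → ℝ≥0∞ := fun j x => ENNReal.ofReal (((2 : ℝ) ^ j) ^ s₁) * M j x ^ p⁻¹ with ht
  have htmeas : ∀ j, Measurable (t j) := fun j => ((hMmeas j).pow_const _).const_mul _
  refine ⟨fun k x => D * ∑' i : ℕ, θ ^ i * t (k + i) x, ⟨fun k => ?_, ∅, measure_empty, ?_⟩, ?_⟩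
  · exact (Measurable.tsum fun i => (htmeas _).const_mul _).const_mul _
  · intro k x _ x' _ h1 h2
    rw [ofReal_abs_sub_eq_edist]
    refine (hv k x x' h1 h2).trans ?_
    have hd : (2 : ℝ) ^ (-k) ≤ 2 * dist x x' := by
      rw [← neg_add', two_zpow_neg_succ] at h1
      linarith
    have hterm : ∀ (y : X) (i : ℕ), S.mass μ p g (k + i, S.net (k + i) y) ^ p⁻¹ ≤
        ENNReal.ofReal (2 ^ s₁) * ENNReal.ofReal (dist x x' ^ s₁) * (θ ^ i * t (k + i) y) := by
      intro y i
      have hone : (1 : ℝ≥0∞) ≤ ENNReal.ofReal (2 ^ s₁) * ENNReal.ofReal (dist x x' ^ s₁) *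
          (θ ^ i * ENNReal.ofReal (((2 : ℝ) ^ (k + i)) ^ s₁)) := by
        rw [hθ, ← ENNReal.ofReal_pow (by positivity), ← ENNReal.ofReal_mul (by positivity),
          ← ENNReal.ofReal_mul (by positivity), ← ENNReal.ofReal_mul (by positivity),
          ENNReal.one_le_ofReal, ← Real.rpow_natCast, ← Real.rpow_mul (by norm_num),
          mul_comm s₁, Real.rpow_mul (by norm_num), ← Real.mul_rpow (by norm_num) dist_nonneg,
          ← Real.mul_rpow (by positivity) (by positivity),
          ← Real.mul_rpow (by positivity) (by positivity)]
        refine Real.one_le_rpow ?_ hs₁.le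
        rw [Real.rpow_natCast, zpow_add₀ two_ne_zero, zpow_natCast]
        have h3 : (1 / 2 : ℝ) ^ i * (2 ^ k * 2 ^ i) = 2 ^ k := by
          rw [one_div, inv_pow]
          field_simp
        rw [h3]
        calc (1 : ℝ) = 2 ^ (-k) * 2 ^ k := by rw [← zpow_add₀ two_ne_zero]; simp
          _ ≤ 2 * dist x x' * 2 ^ k := by gcongr
      calc S.mass μ p g (k + i, S.net (k + i) y) ^ p⁻¹ ≤ 1 * M (k + i) y ^ p⁻¹ := by
            rw [one_mul]
            gcongr
            exact hmassM _ _
        _ ≤ _ := mul_le_mul' hone le_rfl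
        _ = _ := by simp only [ht]; ring
    have hsum : ∀ y : X, ∑' i : ℕ, S.mass μ p g (k + i, S.net (k + i) y) ^ p⁻¹ ≤
        ENNReal.ofReal (2 ^ s₁) * ENNReal.ofReal (dist x x' ^ s₁) *
          ∑' i : ℕ, θ ^ i * t (k + i) y := by
      intro y
      rw [← ENNReal.tsum_mul_left]
      exact ENNReal.tsum_le_tsum (hterm y)
    calc _ ≤ 7 * c * (_ + _) := mul_le_mul' le_rfl (add_le_add (hsum x) (hsum x'))
      _ = _ := by rw [hD]; ring
  · have hpoint : ∀ x, ∑' k : ℤ, (D * ∑' i : ℕ, θ ^ i * t (k + i) x) ^ p ≤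
        D ^ p * ((1 - θ)⁻¹ ^ (p - 1) * (1 - θ)⁻¹) * ∑' j, t j x ^ p := by
      intro x
      simp_rw [ENNReal.mul_rpow_of_nonneg _ _ hp0.le]
      rw [ENNReal.tsum_mul_left, mul_assoc]
      gcongr
      exact ENNReal.tsum_tsum_pow_mul_rpow_le hp θ fun j => t j x
    have hint : ∀ j, ∫⁻ x, t j x ^ p ∂ν ≤ a₂ * ∑' z, S.mass μ p g (j, z) := by
      intro j
      have h1 : ∀ x, t j x ^ p = ENNReal.ofReal (((2 : ℝ) ^ j) ^ (s₁ * p)) * M j x := by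
        intro x
        simp only [ht]
        rw [ENNReal.mul_rpow_of_nonneg _ _ hp0.le, ENNReal.rpow_inv_rpow hp0.ne',
          ENNReal.ofReal_rpow_of_nonneg (by positivity) hp0.le, ← Real.rpow_mul (htwo j).le]
      simp_rw [h1]
      rw [lintegral_const_mul _ (hMmeas j), lintegral_tsum_indicator ν (hmassj j) (hB j),
        ← ENNReal.tsum_mul_left, ← ENNReal.tsum_mul_left]
      refine ENNReal.tsum_le_tsum fun z => ?_
      by_cases hj : AdmissibleScale X j
      · have h2 := hAX z _ (by have := htwo (-j); positivity) hj
        have h3 : ENNReal.ofReal (((2 : ℝ) ^ j) ^ (s₁ * p)) *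
            ENNReal.ofReal (((2 : ℝ) ^ (-j) / 8) ^ (s₁ * p)) ≤ 1 := by
          rw [← ENNReal.ofReal_mul (by positivity), ENNReal.ofReal_le_one,
            ← Real.mul_rpow (by positivity) (by positivity)]
          refine Real.rpow_le_one (by positivity) ?_ (by positivity)
          rw [← mul_div_assoc, ← zpow_add₀ two_ne_zero]
          norm_num
        calc _ ≤ ENNReal.ofReal (((2 : ℝ) ^ j) ^ (s₁ * p)) * (S.mass μ p g (j, z) *
              (a₂ * ENNReal.ofReal (((2 : ℝ) ^ (-j) / 8) ^ (s₁ * p)))) := by gcongr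
          _ = a₂ * S.mass μ p g (j, z) * (ENNReal.ofReal (((2 : ℝ) ^ j) ^ (s₁ * p)) *
              ENNReal.ofReal (((2 : ℝ) ^ (-j) / 8) ^ (s₁ * p))) := by ring
          _ ≤ a₂ * S.mass μ p g (j, z) * 1 := by gcongr
          _ = _ := mul_one _
      · have h2 : S.mass μ p g (j, z) = 0 := by
          have : ∀ y i, ¬ S.Near (j, z) y i := fun y i h => hj h.1
          simp [NodeSystem.mass, this]
        simp [h2]
    calc ∫⁻ x, ∑' k : ℤ, (D * ∑' i : ℕ, θ ^ i * t (k + i) x) ^ p ∂ν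
        ≤ ∫⁻ x, D ^ p * ((1 - θ)⁻¹ ^ (p - 1) * (1 - θ)⁻¹) * ∑' j, t j x ^ p ∂ν :=
          lintegral_mono hpoint
      _ = D ^ p * ((1 - θ)⁻¹ ^ (p - 1) * (1 - θ)⁻¹) * ∑' j, ∫⁻ x, t j x ^ p ∂ν := by
          rw [lintegral_const_mul _ (Measurable.tsum fun j => (htmeas j).pow_const p),
            lintegral_tsum fun j => ((htmeas j).pow_const p).aemeasurable]
      _ ≤ D ^ p * ((1 - θ)⁻¹ ^ (p - 1) * (1 - θ)⁻¹) *
          (a₂ * (K * ∫⁻ y, ∑' j, g j y ^ p ∂μ)) := by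
          gcongr
          refine (ENNReal.tsum_le_tsum hint).trans ?_
          rw [ENNReal.tsum_mul_left]
          gcongr
      _ = _ := by ring

theorem IsFracHajlaszGradient.zero_of_hajlaszTLNorm_eq_zero {X : Type*} [MetricSpace X]
    [MeasurableSpace X] {μ : Measure X} {s p : ℝ} (hp : 0 < p) {u : X → ℝ}
    (h : hajlaszTLNorm μ s p u = 0) : IsFracHajlaszGradient μ s u fun _ _ => 0 := by
  have hex : ∀ m : ℕ, ∃ g, IsFracHajlaszGradient μ s u g ∧
      ∫⁻ x, ∑' k : ℤ, g k x ^ p ∂μ ≤ 2⁻¹ ^ m := by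
    intro m
    have hlt : hajlaszTLNorm μ s p u < ((2⁻¹ : ℝ≥0∞) ^ m) ^ (1 / p) := by
      rw [h]
      exact ENNReal.rpow_pos (ENNReal.pow_pos (by simp) m) (ENNReal.pow_ne_top (by simp))
    obtain ⟨g, hg⟩ := iInf_lt_iff.1 hlt
    obtain ⟨hg1, hg2⟩ := iInf_lt_iff.1 hg
    exact ⟨g, hg1, ((ENNReal.rpow_lt_rpow_iff (by positivity)).1 hg2).le⟩
  choose g hg hgint using hex
  choose E hE hgE using fun m => (hg m).2
  have hmeas : ∀ m, Measurable fun x => ∑' k : ℤ, g m k x ^ p := fun m =>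
    Measurable.tsum fun k => ((hg m).1 k).pow_const p
  have hfin : ∫⁻ x, ∑' m : ℕ, ∑' k : ℤ, g m k x ^ p ∂μ ≠ ∞ := by
    rw [lintegral_tsum fun m => (hmeas m).aemeasurable]
    refine ne_top_of_le_ne_top ?_ (ENNReal.tsum_le_tsum hgint)
    rw [ENNReal.tsum_geometric]
    simp
  refine ⟨fun _ => measurable_const,
    {x | ¬ ∑' m : ℕ, ∑' k : ℤ, g m k x ^ p < ∞} ∪ ⋃ m, E m, ?_, ?_⟩
  · exact measure_union_null (ae_iff.1 (ae_lt_top (Measurable.tsum hmeas) hfin))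
      (measure_iUnion_null hE)
  · intro k x hx y hy h1 h2
    rw [Set.mem_union, not_or] at hx hy
    have hlim : ∀ x, x ∉ {x | ¬ ∑' m : ℕ, ∑' k : ℤ, g m k x ^ p < ∞} →
        Filter.Tendsto (fun m => g m k x) Filter.atTop (nhds 0) := by
      intro x hx
      have hx' : ∑' m : ℕ, ∑' k : ℤ, g m k x ^ p < ∞ := not_not.1 hx
      have h3 : Filter.Tendsto (fun m => g m k x ^ p) Filter.atTop (nhds 0) :=
        tendsto_of_tendsto_of_tendsto_of_le_of_le tendsto_const_nhds
          (ENNReal.tendsto_atTop_zero_of_tsum_ne_top hx'.ne) (fun _ => zero_le)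
          fun m => ENNReal.le_tsum k
      have h4 := h3.ennrpow_const p⁻¹
      simpa only [ENNReal.rpow_rpow_inv hp.ne', ENNReal.zero_rpow_of_pos (inv_pos.2 hp)] using h4
    have h3 := ENNReal.Tendsto.const_mul (a := ENNReal.ofReal (dist x y ^ s))
      ((hlim x hx.1).add (hlim y hy.1)) (Or.inr ENNReal.ofReal_ne_top)
    refine ge_of_tendsto' h3 fun m => hgE m k x ?_ y ?_ h1 h2
    · exact fun h => hx.2 (Set.mem_iUnion.2 ⟨m, h⟩)
    · exact fun h => hy.2 (Set.mem_iUnion.2 ⟨m, h⟩)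

theorem exists_gradient_le_two_mul {X : Type*} [MetricSpace X] [MeasurableSpace X]
    {μ : Measure X} {s p : ℝ} (hp : 0 < p) {u : X → ℝ} (h : hajlaszTLNorm μ s p u ≠ ∞) :
    ∃ g, IsFracHajlaszGradient μ s u g ∧
      (∫⁻ x, ∑' k : ℤ, g k x ^ p ∂μ) ^ (1 / p) ≤ 2 * hajlaszTLNorm μ s p u := by
  by_cases h0 : hajlaszTLNorm μ s p u = 0
  · refine ⟨_, .zero_of_hajlaszTLNorm_eq_zero hp h0, ?_⟩
    simp [hp]
  · have hlt : hajlaszTLNorm μ s p u < 2 * hajlaszTLNorm μ s p u := by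
      rw [two_mul]
      exact ENNReal.lt_add_right h h0
    obtain ⟨g, hg⟩ := iInf_lt_iff.1 hlt
    obtain ⟨hg1, hg2⟩ := iInf_lt_iff.1 hg
    exact ⟨g, hg1, hg2.le⟩

/-- Composition with a homeomorphism controlling ratios is bounded, after passing to suitable
representatives. -/
theorem ControlsRatios.exists_hajlaszTLNorm_comp_le {X Y : Type*} [MetricSpace X]
    [MeasurableSpace X] [BorelSpace X] [MetricSpace Y] [MeasurableSpace Y] [BorelSpace Y]
    {f : X ≃ₜ Y} (hf : ControlsRatios f) (ν : Measure X) (μ : Measure Y) {s₁ s₂ p : ℝ}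
    (hs₁ : 0 < s₁) (hs₂ : 0 < s₂) (hp : 1 ≤ p) {a₁ a₂ b₁ b₂ : ℝ≥0∞} (ha₁ : 0 < a₁)
    (ha₂ : a₂ ≠ ∞) (hb₁ : 0 < b₁) (hb₂ : b₂ ≠ ∞)
    (hAX : ∀ (x : X) (r : ℝ), 0 < r → ENNReal.ofReal r < Metric.ediam (Set.univ : Set X) →
      a₁ * ENNReal.ofReal (r ^ (s₁ * p)) ≤ ν (Metric.ball x r) ∧
      ν (Metric.ball x r) ≤ a₂ * ENNReal.ofReal (r ^ (s₁ * p)))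
    (hAY : ∀ (y : Y) (r : ℝ), 0 < r → ENNReal.ofReal r < Metric.ediam (Set.univ : Set Y) →
      b₁ * ENNReal.ofReal (r ^ (s₂ * p)) ≤ μ (Metric.ball y r) ∧
      μ (Metric.ball y r) ≤ b₂ * ENNReal.ofReal (r ^ (s₂ * p))) :
    ∃ c : ℝ≥0∞, c ≠ ∞ ∧ ∀ u : Y → ℝ, hajlaszTLNorm μ s₂ p u ≠ ∞ → ∃ v : Y → ℝ, v =ᵐ[μ] u ∧
      hajlaszTLNorm ν s₁ p (v ∘ f) ≤ c * hajlaszTLNorm μ s₂ p u := by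
  have hp0 : 0 < p := by linarith
  rcases subsingleton_or_nontrivial X with hX | hX
  · refine ⟨0, by simp, fun u _ => ⟨u, .rfl, ?_⟩⟩
    have hzero : IsFracHajlaszGradient ν s₁ (u ∘ f) fun _ _ => 0 := by
      refine ⟨fun _ => measurable_const, ∅, measure_empty, fun k x _ y _ _ _ => ?_⟩
      rw [Subsingleton.elim x y]
      simp
    refine (iInf₂_le _ hzero).trans ?_
    simp [hp0]
  · obtain ⟨x, y, hxy⟩ := exists_pair_ne X
    obtain ⟨k, hk, -⟩ := exists_dyadic_scale (dist_pos.2 hxy)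
    obtain ⟨e, he, he1, hperf⟩ := exists_annulus_point ν (by positivity) ha₁ ha₂ hAX
    obtain ⟨C, K, ⟨S⟩⟩ := exists_nodeSystem hf he he1 hperf
    obtain ⟨c, hc, hcS⟩ := S.exists_gradient ν μ hs₁ hs₂ hp ha₂ hb₁ hb₂
      (fun x r h h' => (hAX x r h h').2) hAY ⟨k, .of_dist hk⟩
    have hp' : 0 ≤ 1 / p := by positivity
    refine ⟨c ^ (1 / p) * 2, ENNReal.mul_ne_top (ENNReal.rpow_ne_top_of_nonneg hp' hc) (by simp),
      fun u hu => ?_⟩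
    obtain ⟨g, hg, hgu⟩ := exists_gradient_le_two_mul hp0 hu
    have hfin : ∫⁻ y, ∑' j, g j y ^ p ∂μ ≠ ∞ := by
      intro htop
      rw [htop, ENNReal.top_rpow_of_pos (by positivity)] at hgu
      exact ENNReal.mul_ne_top (by simp) hu (top_le_iff.1 hgu)
    obtain ⟨v, hvu, G, hG, hGint⟩ := hcS u g hg hfin
    refine ⟨v, hvu, (iInf₂_le G hG).trans ?_⟩
    calc _ ≤ (c * ∫⁻ y, ∑' j, g j y ^ p ∂μ) ^ (1 / p) := ENNReal.rpow_le_rpow hGint hp'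
      _ = c ^ (1 / p) * (∫⁻ y, ∑' j, g j y ^ p ∂μ) ^ (1 / p) :=
          ENNReal.mul_rpow_of_nonneg _ _ hp'
      _ ≤ c ^ (1 / p) * (2 * hajlaszTLNorm μ s₂ p u) := by gcongr
      _ = _ := by ring

/-- Theorem 5.1: if `X` is Ahlfors `n₁`-regular, `Y` is Ahlfors `n₂`-regular,
`f : X → Y` is an `η`-quasisymmetric homeomorphism, and `s₁ ∈ (0,n₁)`, `s₂ ∈ (0,n₂)`
satisfy `n₁/s₁ = n₂/s₂`, then `f` induces an equivalence between
`Ṁ^{s₁}_{n₁/s₁,n₁/s₁}(X)` and `Ṁ^{s₂}_{n₂/s₂,n₂/s₂}(Y)`: every `u` has a representative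
`ũ` with `‖ũ∘f‖ ≲ ‖u‖`, and symmetrically for `f⁻¹`. -/
theorem quasisymmetric_invariance_matching_exponents
    {X Y : Type*} [MetricSpace X] [MeasurableSpace X] [BorelSpace X]
    [MetricSpace Y] [MeasurableSpace Y] [BorelSpace Y]
    (μX : Measure X) (μY : Measure Y) (n₁ n₂ s₁ s₂ : ℝ)
    (hn₁ : 0 < n₁) (hn₂ : 0 < n₂) (hs₁ : 0 < s₁) (hs₁n : s₁ < n₁)
    (hs₂ : 0 < s₂) (hs₂n : s₂ < n₂) (hmatch : n₁ / s₁ = n₂ / s₂)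
    (a₁ a₂ b₁ b₂ : ℝ≥0∞) (ha₁ : 0 < a₁) (ha₂ : a₂ ≠ ∞) (hb₁ : 0 < b₁) (hb₂ : b₂ ≠ ∞)
    (hAX : ∀ (x : X) (r : ℝ), 0 < r →
      ENNReal.ofReal r < EMetric.diam (Set.univ : Set X) →
      a₁ * ENNReal.ofReal (r ^ n₁) ≤ μX (Metric.ball x r) ∧
      μX (Metric.ball x r) ≤ a₂ * ENNReal.ofReal (r ^ n₁))
    (hAY : ∀ (y : Y) (r : ℝ), 0 < r →
      ENNReal.ofReal r < EMetric.diam (Set.univ : Set Y) →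
      b₁ * ENNReal.ofReal (r ^ n₂) ≤ μY (Metric.ball y r) ∧
      μY (Metric.ball y r) ≤ b₂ * ENNReal.ofReal (r ^ n₂))
    (f : X ≃ₜ Y) (η : ℝ → ℝ) (hqs : IsQuasisymmetric (⇑f) η) :
    ∃ C : ℝ≥0∞, 0 < C ∧ C ≠ ∞ ∧
      (∀ u : Y → ℝ, Measurable u → ∃ v : Y → ℝ, v =ᵐ[μY] u ∧
        hajlaszTLNorm μX s₁ (n₁ / s₁) (v ∘ ⇑f) ≤ C * hajlaszTLNorm μY s₂ (n₂ / s₂) u) ∧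
      (∀ u : X → ℝ, Measurable u → ∃ v : X → ℝ, v =ᵐ[μX] u ∧
        hajlaszTLNorm μY s₂ (n₂ / s₂) (v ∘ ⇑f.symm) ≤ C * hajlaszTLNorm μX s₁ (n₁ / s₁) u) := by
  obtain ⟨p, hp⟩ : ∃ p, p = n₁ / s₁ := ⟨_, rfl⟩
  rw [← hmatch, ← hp]
  obtain rfl : n₁ = s₁ * p := by rw [hp]; field_simp
  obtain rfl : n₂ = s₂ * p := by rw [hp, hmatch]; field_simp
  have hp1 : 1 ≤ p := by
    by_contra! hlt
    nlinarith
  have hf := hqs.controlsRatios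
  obtain ⟨c, hc, hcf⟩ := hf.exists_hajlaszTLNorm_comp_le μX μY hs₁ hs₂ hp1 ha₁ ha₂ hb₁ hb₂ hAX hAY
  obtain ⟨d, hd, hdf⟩ :=
    hf.symm.exists_hajlaszTLNorm_comp_le μY μX hs₂ hs₁ hp1 hb₁ hb₂ ha₁ ha₂ hAY hAX
  have hpos : 0 < c + d + 1 := lt_of_lt_of_le one_pos le_add_self
  refine ⟨c + d + 1, hpos, by simp [hc, hd], fun u _ => ?_, fun u _ => ?_⟩
  · by_cases hu : hajlaszTLNorm μY s₂ p u = ∞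
    · refine ⟨u, .rfl, ?_⟩
      rw [hu, ENNReal.mul_top hpos.ne']
      exact le_top
    · obtain ⟨v, hvu, hv⟩ := hcf u hu
      refine ⟨v, hvu, hv.trans ?_⟩
      gcongr
      rw [add_assoc]
      exact le_self_add
  · by_cases hu : hajlaszTLNorm μX s₁ p u = ∞
    · refine ⟨u, .rfl, ?_⟩
      rw [hu, ENNReal.mul_top hpos.ne']
      exact le_top
    · obtain ⟨v, hvu, hv⟩ := hdf u hu
      refine ⟨v, hvu, hv.trans ?_⟩
      gcongr
      rw [add_right_comm]
      exact le_add_self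
end
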